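/- arXiv:1812.10075 — 4 statements merged into one kernel-verified Lean document; each statement's English description precedes it below -/
import Mathlib

section
/- Let (u, ρ) be a classical solution of the R2CH system on [0,T). Then the energy E(t) = ∫_ℝ ( u(t,x)² + (∂_x u(t,x))² + (1 − 2ΩA)(ρ(t,x) − 1)² ) dx is conserved: E(t) = E(0) for all t ∈ [0,T). (Lemma 2.2) -/
open Set Filter MeasureTheory Topology Real

/-- A classical solution of the rotation-two-component Camassa–Holm (R2CH) system
on `[0,T) × ℝ`:  `u` has continuous spatial derivatives up to order three and a
continuous time derivative (also of `∂ₓ²u`), `ρ` has a continuous spatial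
derivative and a continuous time derivative, both equations hold pointwise,
`u(t,·), ∂ₓu(t,·), ∂ₓ²u(t,·), ρ(t,·)-1, ∂ₓρ(t,·)` are square integrable,
`ρ(t,·)-1` is bounded and `u → 0`, `∂ₓu → 0`, `ρ → 1` as `|x| → ∞`. -/
structure R2CHSolution (A μ σ Ω T : ℝ) (u ρ : ℝ → ℝ → ℝ) : Prop where
  T_pos : 0 < T
  u_smooth : ∀ t ∈ Ico (0:ℝ) T, ContDiff ℝ 3 (u t)
  ρ_smooth : ∀ t ∈ Ico (0:ℝ) T, ContDiff ℝ 1 (ρ t)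
  u_jcont : ∀ k : ℕ, k ≤ 3 →
    ContinuousOn (fun p : ℝ × ℝ => iteratedDeriv k (u p.1) p.2) (Ico 0 T ×ˢ (univ : Set ℝ))
  ρ_jcont : ∀ k : ℕ, k ≤ 1 →
    ContinuousOn (fun p : ℝ × ℝ => iteratedDeriv k (ρ p.1) p.2) (Ico 0 T ×ˢ (univ : Set ℝ))
  u_tdiff : ∀ x : ℝ, ∀ t ∈ Ico (0:ℝ) T,
    DifferentiableWithinAt ℝ (fun s => u s x) (Ico 0 T) t
  uxx_tdiff : ∀ x : ℝ, ∀ t ∈ Ico (0:ℝ) T,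
    DifferentiableWithinAt ℝ (fun s => deriv (deriv (u s)) x) (Ico 0 T) t
  ρ_tdiff : ∀ x : ℝ, ∀ t ∈ Ico (0:ℝ) T,
    DifferentiableWithinAt ℝ (fun s => ρ s x) (Ico 0 T) t
  ut_jcont : ContinuousOn
    (fun p : ℝ × ℝ => derivWithin (fun s => u s p.2) (Ico 0 T) p.1) (Ico 0 T ×ˢ (univ : Set ℝ))
  utxx_jcont : ContinuousOn
    (fun p : ℝ × ℝ => derivWithin (fun s => deriv (deriv (u s)) p.2) (Ico 0 T) p.1)
    (Ico 0 T ×ˢ (univ : Set ℝ))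
  ρt_jcont : ContinuousOn
    (fun p : ℝ × ℝ => derivWithin (fun s => ρ s p.2) (Ico 0 T) p.1) (Ico 0 T ×ˢ (univ : Set ℝ))
  eq_u : ∀ t ∈ Ico (0:ℝ) T, ∀ x : ℝ,
    derivWithin (fun s => u s x) (Ico 0 T) t
      - derivWithin (fun s => deriv (deriv (u s)) x) (Ico 0 T) t
      - A * deriv (u t) x + 3 * u t x * deriv (u t) x
    = σ * (2 * deriv (u t) x * deriv (deriv (u t)) x
            + u t x * deriv (deriv (deriv (u t))) x)
      - μ * deriv (deriv (deriv (u t))) x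
      - (1 - 2 * Ω * A) * ρ t x * deriv (ρ t) x
      + 2 * Ω * ρ t x * deriv (fun y => ρ t y * u t y) x
  eq_ρ : ∀ t ∈ Ico (0:ℝ) T, ∀ x : ℝ,
    derivWithin (fun s => ρ s x) (Ico 0 T) t + deriv (fun y => u t y * ρ t y) x = 0
  u_L2 : ∀ t ∈ Ico (0:ℝ) T, Integrable (fun x => (u t x) ^ 2)
  ux_L2 : ∀ t ∈ Ico (0:ℝ) T, Integrable (fun x => (deriv (u t) x) ^ 2)
  uxx_L2 : ∀ t ∈ Ico (0:ℝ) T, Integrable (fun x => (deriv (deriv (u t)) x) ^ 2)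
  ρm1_L2 : ∀ t ∈ Ico (0:ℝ) T, Integrable (fun x => (ρ t x - 1) ^ 2)
  ρx_L2 : ∀ t ∈ Ico (0:ℝ) T, Integrable (fun x => (deriv (ρ t) x) ^ 2)
  ρm1_Linf : ∀ t ∈ Ico (0:ℝ) T, ∃ B : ℝ, ∀ x : ℝ, |ρ t x - 1| ≤ B
  u_decay : ∀ t ∈ Ico (0:ℝ) T, Tendsto (u t) (cocompact ℝ) (𝓝 0)
  ux_decay : ∀ t ∈ Ico (0:ℝ) T, Tendsto (deriv (u t)) (cocompact ℝ) (𝓝 0)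
  ρ_decay : ∀ t ∈ Ico (0:ℝ) T, Tendsto (ρ t) (cocompact ℝ) (𝓝 1)

/-- The energy `E(t) = ∫ (u² + uₓ² + (1-2ΩA)(ρ-1)²) dx`. -/
noncomputable def energy (Ω A : ℝ) (u ρ : ℝ → ℝ → ℝ) (t : ℝ) : ℝ :=
  ∫ x : ℝ, ((u t x) ^ 2 + (deriv (u t) x) ^ 2 + (1 - 2 * Ω * A) * (ρ t x - 1) ^ 2)

/-- Differentiation under a compact interval integral, with one-sided derivatives allowed at the
endpoints of the parameter interval. -/
theorem hasDerivWithinAt_intervalIntegral {a b c d : ℝ} (hcd : c ≤ d) {F F' : ℝ → ℝ → ℝ}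
    (hF : ∀ t, Continuous (F t)) (hF' : Continuous (fun p : ℝ × ℝ => F' p.1 p.2))
    (h : ∀ y, ∀ t ∈ Icc a b, HasDerivWithinAt (fun s => F s y) (F' t y) (Icc a b) t) :
    ∀ t ∈ Icc a b, HasDerivWithinAt (fun s => ∫ y in c..d, F s y) (∫ y in c..d, F' t y)
      (Icc a b) t := by
  have key : ∀ s ∈ Icc a b,
      ∫ y in c..d, F s y = (∫ y in c..d, F a y) + ∫ τ in a..s, ∫ y in c..d, F' τ y := by
    intro s hs
    have h1 : ∀ y, F s y = F a y + ∫ τ in a..s, F' τ y := by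
      intro y
      have := intervalIntegral.integral_eq_sub_of_hasDerivAt_of_le (f := fun τ => F τ y)
        (f' := fun τ => F' τ y) hs.1
        (fun τ hτ => ((h y τ ⟨hτ.1, hτ.2.trans hs.2⟩).continuousWithinAt).mono
          (Icc_subset_Icc_right hs.2))
        (fun τ hτ => (h y τ ⟨hτ.1.le, hτ.2.le.trans hs.2⟩).hasDerivAt
          (Icc_mem_nhds hτ.1 (hτ.2.trans_le hs.2)))
        ((by fun_prop : Continuous fun τ => F' τ y).intervalIntegrable _ _)
      linarith
    have hint : Continuous fun y => ∫ τ in a..s, F' τ y :=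
      intervalIntegral.continuous_parametric_intervalIntegral_of_continuous' (by fun_prop) _ _
    simp_rw [h1]
    rw [intervalIntegral.integral_add ((hF a).intervalIntegrable _ _)
      (hint.intervalIntegrable _ _)]
    congr 1
    rw [intervalIntegral.integral_of_le hcd, intervalIntegral.integral_of_le hs.1]
    simp_rw [intervalIntegral.integral_of_le hcd, intervalIntegral.integral_of_le hs.1]
    apply MeasureTheory.integral_integral_swap
    rw [Measure.prod_restrict]
    have : IntegrableOn (Function.uncurry fun y τ => F' τ y) (Icc c d ×ˢ Icc a s)
        ((volume : Measure ℝ).prod volume) :=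
      ContinuousOn.integrableOn_compact (isCompact_Icc.prod isCompact_Icc)
        (by fun_prop : Continuous fun p : ℝ × ℝ => F' p.2 p.1).continuousOn
    exact this.mono_set (prod_mono Ioc_subset_Icc_self Ioc_subset_Icc_self)
  intro t ht
  have hc : Continuous fun τ => ∫ y in c..d, F' τ y :=
    intervalIntegral.continuous_parametric_intervalIntegral_of_continuous' (by fun_prop) _ _
  have hd : HasDerivAt (fun s => (∫ y in c..d, F a y) + ∫ τ in a..s, ∫ y in c..d, F' τ y)
      (∫ y in c..d, F' t y) t :=
    (intervalIntegral.integral_hasDerivAt_right (hc.intervalIntegrable _ _)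
      (hc.stronglyMeasurableAtFilter _ _) hc.continuousAt).const_add _
  exact hd.hasDerivWithinAt.congr key (key t ht)

/-- Two-sided version of `hasDerivWithinAt_intervalIntegral` for globally differentiable
integrands. -/
theorem hasDerivAt_intervalIntegral {c d : ℝ} (hcd : c ≤ d) {F F' : ℝ → ℝ → ℝ}
    (hF : ∀ t, Continuous (F t)) (hF' : Continuous (fun p : ℝ × ℝ => F' p.1 p.2))
    (h : ∀ y t, HasDerivAt (fun s => F s y) (F' t y) t) (t : ℝ) :
    HasDerivAt (fun s => ∫ y in c..d, F s y) (∫ y in c..d, F' t y) t :=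
  (hasDerivWithinAt_intervalIntegral (a := t - 1) (b := t + 1) hcd hF hF'
    (fun y s _ => (h y s).hasDerivWithinAt) t ⟨by linarith, by linarith⟩).hasDerivAt
    (Icc_mem_nhds (by linarith) (by linarith))

theorem abs_le_of_hasDerivWithinAt_of_lipschitz {a b C t f' : ℝ} {f : ℝ → ℝ} (hab : a < b)
    (ht : t ∈ Icc a b) (hd : HasDerivWithinAt f f' (Icc a b) t)
    (hl : ∀ s ∈ Icc a b, |f s - f t| ≤ C * |s - t|) : |f'| ≤ C := by
  rw [hasDerivWithinAt_iff_tendsto_slope] at hd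
  have : (𝓝[Icc a b \ {t}] t).NeBot := by
    have := (uniqueDiffOn_Icc hab t ht).accPt
    rwa [accPt_principal_iff_nhdsWithin] at this
  refine le_of_tendsto hd.abs ?_
  filter_upwards [self_mem_nhdsWithin] with s hs
  have hne : s - t ≠ 0 := sub_ne_zero.2 hs.2
  rw [slope_def_field, abs_div, div_le_iff₀ (abs_pos.2 hne)]
  exact hl s hs.1

theorem nonneg_of_hasDerivWithinAt_of_le {a b t f' : ℝ} {f : ℝ → ℝ} (hat : a < t) (htb : t ≤ b)
    (hd : HasDerivWithinAt f f' (Icc a b) t) (hl : ∀ s ∈ Icc a t, f s ≤ f t) : 0 ≤ f' := by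
  have hd := hd.mono (Icc_subset_Icc_right htb)
  rw [hasDerivWithinAt_iff_tendsto_slope] at hd
  have : (𝓝[Icc a t \ {t}] t).NeBot := by
    have := (uniqueDiffOn_Icc hat t ⟨hat.le, le_rfl⟩).accPt
    rwa [accPt_principal_iff_nhdsWithin] at this
  refine ge_of_tendsto hd ?_
  filter_upwards [self_mem_nhdsWithin] with s hs
  rw [slope_def_field]
  exact div_nonneg_of_nonpos (by linarith [hl s hs.1]) (by linarith [hs.1.2])

/-- A square integrable function with square integrable derivative that vanishes at `-∞` is
bounded by its `H¹` norm. -/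
theorem sq_le_integral_sq_add_sq {f f' : ℝ → ℝ} (hd : ∀ x, HasDerivAt f (f' x) x)
    (hf' : Continuous f') (h0 : Tendsto f atBot (𝓝 0))
    (hi : Integrable fun x => f x ^ 2) (hi' : Integrable fun x => f' x ^ 2) (x : ℝ) :
    f x ^ 2 ≤ (∫ y, f y ^ 2) + ∫ y, f' y ^ 2 := by
  have hc : Continuous f := continuous_iff_continuousAt.2 fun x => (hd x).continuousAt
  have hint : Integrable fun y => 2 * f y * f' y := by
    refine (hi.add hi').mono' (by fun_prop) (Eventually.of_forall fun y => ?_)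
    simp only [Pi.add_apply, Real.norm_eq_abs, abs_le]
    constructor <;> nlinarith [sq_nonneg (f y + f' y), sq_nonneg (f y - f' y)]
  have h1 : ∫ y in Iic x, 2 * f y * f' y = f x ^ 2 - 0 := by
    refine integral_Iic_of_hasDerivAt_of_tendsto (f := fun y => f y ^ 2)
      (by fun_prop) (fun y _ => ?_) hint.integrableOn (by simpa using h0.pow 2)
    simpa using (hd y).fun_pow 2
  rw [← integral_add hi hi', ← sub_zero (f x ^ 2), ← h1]
  refine (setIntegral_mono_on hint.integrableOn (hi.add hi').integrableOn measurableSet_Iic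
    (g := fun y => f y ^ 2 + f' y ^ 2) fun y _ => ?_).trans
    (setIntegral_le_integral (hi.add hi') (Eventually.of_forall fun y => ?_))
  · nlinarith [sq_nonneg (f y - f' y)]
  · simp only [Pi.zero_apply]; positivity

theorem constant_on_Icc_of_locally_constant {a b : ℝ} (hab : a ≤ b) {f : ℝ → ℝ}
    (h : ∀ t ∈ Icc a b, ∃ δ > 0, ∀ s ∈ Icc a b, |s - t| < δ → f s = f t) : f b = f a := by
  have key : ∀ t ∈ Icc a b, f =ᶠ[𝓝[Icc a b] t] fun _ => f t := by
    intro t ht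
    obtain ⟨δ, hδ, hs⟩ := h t ht
    filter_upwards [self_mem_nhdsWithin, mem_nhdsWithin_of_mem_nhds (Metric.ball_mem_nhds t hδ)]
      with s h1 h2
    exact hs s h1 (by simpa [Real.dist_eq] using h2)
  refine constant_of_has_deriv_right_zero (f := f) (fun t ht => ?_) (fun t ht => ?_) b ⟨hab, le_rfl⟩
  · exact (continuousWithinAt_const (b := f t)).congr_of_eventuallyEq (key t ht) rfl
  · have : HasDerivWithinAt f 0 (Icc a b) t :=
      (hasDerivWithinAt_const t _ (f t)).congr_of_eventuallyEq (key t ⟨ht.1, ht.2.le⟩) rfl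
    refine this.mono_of_mem_nhdsWithin ?_
    exact mem_of_superset (Icc_mem_nhdsGE ht.2) (Icc_subset_Icc_left ht.1)

set_option maxHeartbeats 800000 in
/-- Finite families of functions solving transport inequalities with quadratic right-hand side
cannot blow up immediately: a bound at the initial time persists, uniformly on the whole line,
for a short time.  No control at spatial infinity is required at later times. -/
theorem exists_forall_le_of_transport_le {ι : Type*} [Finite ι] {a b B C L : ℝ}
    {g gt gx V : ι → ℝ → ℝ → ℝ} (hB : 1 ≤ B) (hC : 0 ≤ C) (hL : 0 ≤ L)
    (hg : ∀ i, Continuous fun p : ℝ × ℝ => g i p.1 p.2)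
    (hgt : ∀ i x, ∀ t ∈ Icc a b, HasDerivWithinAt (fun s => g i s x) (gt i t x) (Icc a b) t)
    (hgx : ∀ i t x, HasDerivAt (g i t) (gx i t x) x)
    (hV : ∀ i, ∀ t ∈ Icc a b, ∀ x, |V i t x| ≤ L)
    (hineq : ∀ t ∈ Icc a b, ∀ x, ∀ S, 1 ≤ S → (∀ j, g j t x ≤ S) →
      ∀ i, gt i t x + V i t x * gx i t x ≤ C * S ^ 2)
    (h0 : ∀ i x, g i a x < B) :
    ∃ δ > 0, ∃ B', ∀ t ∈ Icc a b, t ≤ a + δ → ∀ x i, g i t x ≤ B' := by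
  set K : ℝ := C * B + 2 * L + 1 with hK
  have hKpos : 0 < K := by positivity
  have main : ∀ η > 0, η < 1 → ∀ t ∈ Icc a b, ∀ x, 0 ≤ 1 - K * (t - a) - (η * x) ^ 2 →
      ∀ i, g i t x * (1 - K * (t - a) - (η * x) ^ 2) < B := by
    intro η hη hη1
    by_contra! hcon
    obtain ⟨t₂, ht₂, x₂, hx₂, i₂, hi₂⟩ := hcon
    set den : ℝ → ℝ → ℝ := fun t x => 1 - K * (t - a) - (η * x) ^ 2 with hden
    set bad : Set (ℝ × ℝ) := ⋃ i, {p | p.1 ∈ Icc a b ∧ 0 ≤ den p.1 p.2 ∧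
      B ≤ g i p.1 p.2 * den p.1 p.2} with hbad
    have hdc : Continuous fun p : ℝ × ℝ => den p.1 p.2 := by simp only [hden]; fun_prop
    have hbc : IsClosed bad := by
      refine isClosed_iUnion_of_finite fun i => ?_
      have := hg i
      exact (isClosed_Icc.preimage continuous_fst).inter
        ((isClosed_le continuous_const hdc).inter (isClosed_le continuous_const (this.mul hdc)))
    have hbK : IsCompact bad := by
      refine ((isCompact_Icc (a := a) (b := b)).prod
        (isCompact_Icc (a := -(1 / η)) (b := 1 / η))).of_isClosed_subset hbc ?_
      intro p hp
      obtain ⟨i, h1, h2, -⟩ := mem_iUnion.1 hp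
      refine ⟨h1, abs_le.1 ?_⟩
      have h3 : (η * p.2) ^ 2 ≤ 1 := by
        have : 0 ≤ K * (p.1 - a) := mul_nonneg hKpos.le (by linarith [h1.1])
        simp only [hden] at h2
        linarith
      have h5 := abs_le_of_sq_le_sq (a := η * p.2) (b := 1) (by linarith) one_pos.le
      rw [abs_mul, abs_of_pos hη] at h5
      rw [le_div_iff₀ hη]; linarith
    obtain ⟨⟨t₁, x₁⟩, hp, hmin⟩ := hbK.exists_isMinOn
      ⟨(t₂, x₂), mem_iUnion.2 ⟨i₂, ht₂, hx₂, hi₂⟩⟩ continuous_fst.continuousOn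
    obtain ⟨i, ht₁, hd0, hge⟩ := mem_iUnion.1 hp
    simp only at ht₁ hd0 hge
    have hbefore : ∀ s ∈ Icc a b, s < t₁ → ∀ x j, 0 ≤ den s x → g j s x * den s x < B := by
      intro s hs hst x j hdx
      by_contra! hc
      have := hmin (mem_iUnion.2 ⟨j, hs, hdx, hc⟩ : (s, x) ∈ bad)
      exact absurd hst (not_lt.2 this)
    have hdpos : 0 < den t₁ x₁ := by
      rcases hd0.lt_or_eq with h | h
      · exact h
      · rw [← h] at hge; linarith
    have hat : a < t₁ := by
      rcases ht₁.1.lt_or_eq with h | h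
      · exact h
      · exfalso
        rw [← h] at hge hdpos
        have hle1 : den a x₁ ≤ 1 := by simp only [hden]; nlinarith [sq_nonneg (η * x₁)]
        nlinarith [mul_lt_mul_of_pos_right (h0 i x₁) hdpos]
    have hden_anti : ∀ s ≤ t₁, ∀ x, den t₁ x ≤ den s x := by
      intro s hs x
      simp only [hden]
      nlinarith
    have hle : ∀ x j, 0 < den t₁ x → g j t₁ x * den t₁ x ≤ B := by
      intro x j hdx
      have := hg j
      have hcont : Tendsto (fun s => g j s x * den s x) (𝓝[<] t₁) (𝓝 (g j t₁ x * den t₁ x)) :=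
        ((by fun_prop : Continuous fun s => g j s x * den s x).tendsto t₁).mono_left
          nhdsWithin_le_nhds
      refine le_of_tendsto hcont ?_
      filter_upwards [Ioo_mem_nhdsLT hat] with s hs
      exact (hbefore s ⟨hs.1.le, hs.2.le.trans ht₁.2⟩ hs.2 x j
        (hdx.le.trans (hden_anti s hs.2.le x))).le
    have heq : g i t₁ x₁ * den t₁ x₁ = B := le_antisymm (hle x₁ i hdpos) hge
    set S := g i t₁ x₁ with hS
    have hden1 : den t₁ x₁ ≤ 1 := by
      simp only [hden]; nlinarith [sq_nonneg (η * x₁), mul_pos hKpos (sub_pos.2 hat)]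
    have hSpos : 0 < S := by
      by_contra! hc
      nlinarith
    have hS1 : 1 ≤ S := by nlinarith
    have hSj : ∀ j, g j t₁ x₁ ≤ S := by
      intro j
      have := hle x₁ j hdpos
      rw [← heq] at this
      exact le_of_mul_le_mul_right this hdpos
    have hx : gx i t₁ x₁ * den t₁ x₁ + S * (-(2 * η * (η * x₁))) = 0 := by
      have hd : HasDerivAt (fun x => g i t₁ x * den t₁ x)
          (gx i t₁ x₁ * den t₁ x₁ + g i t₁ x₁ * (-(2 * η * (η * x₁)))) x₁ := by
        refine (hgx i t₁ x₁).mul ?_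
        have := (((hasDerivAt_id x₁).const_mul η).fun_pow 2).const_sub (1 - K * (t₁ - a))
        exact this.congr_deriv (by simp; ring)
      refine IsLocalMax.hasDerivAt_eq_zero ?_ hd
      have hopen : ∀ᶠ x in 𝓝 x₁, 0 < den t₁ x :=
        (by fun_prop : Continuous fun x => den t₁ x).continuousAt.eventually_const_lt hdpos
      filter_upwards [hopen] with x hx
      rw [heq]
      exact hle x i hx
    have ht : 0 ≤ gt i t₁ x₁ * den t₁ x₁ + S * (-K) := by
      have hd : HasDerivWithinAt (fun s => g i s x₁ * den s x₁)
          (gt i t₁ x₁ * den t₁ x₁ + g i t₁ x₁ * (-K)) (Icc a b) t₁ := by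
        refine (hgt i x₁ t₁ ht₁).mul (HasDerivAt.hasDerivWithinAt ?_)
        have := ((((hasDerivAt_id t₁).sub_const a).const_mul K).const_sub 1).sub_const ((η * x₁) ^ 2)
        exact this.congr_deriv (by ring)
      refine nonneg_of_hasDerivWithinAt_of_le hat ht₁.2 hd fun s hs => ?_
      rcases hs.2.lt_or_eq with h | h
      · rw [heq]
        exact (hbefore s ⟨hs.1, hs.2.trans ht₁.2⟩ h x₁ i
          (hdpos.le.trans (hden_anti s hs.2 x₁))).le
      · rw [h]
    have hfin := hineq t₁ ht₁ x₁ S hS1 hSj i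
    have hVb := abs_le.1 (hV i t₁ ht₁ x₁)
    have hηx : |η * x₁| ≤ 1 := by
      refine abs_le_of_sq_le_sq ?_ one_pos.le
      simp only [hden] at hdpos
      nlinarith [mul_pos hKpos (sub_pos.2 hat)]
    have hVx : |V i t₁ x₁ * (2 * η * (η * x₁))| ≤ 2 * L := by
      rw [abs_mul, abs_mul, abs_of_pos (by positivity : 0 < 2 * η)]
      have h1 := hV i t₁ ht₁ x₁
      calc |V i t₁ x₁| * (2 * η * |η * x₁|) ≤ L * (2 * 1 * 1) := by gcongr
        _ = 2 * L := by ring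
    have h1 : den t₁ x₁ * (gt i t₁ x₁ + V i t₁ x₁ * gx i t₁ x₁) ≥ S * (K - 2 * L) := by
      have e : den t₁ x₁ * (gt i t₁ x₁ + V i t₁ x₁ * gx i t₁ x₁)
          = gt i t₁ x₁ * den t₁ x₁ + S * (V i t₁ x₁ * (2 * η * (η * x₁))) := by
        linear_combination V i t₁ x₁ * hx
      rw [e]
      nlinarith [(abs_le.1 hVx).1]
    have h2 : den t₁ x₁ * (gt i t₁ x₁ + V i t₁ x₁ * gx i t₁ x₁) ≤ C * B * S := by
      calc _ ≤ den t₁ x₁ * (C * S ^ 2) := by gcongr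
        _ = C * (S * den t₁ x₁) * S := by ring
        _ = C * B * S := by rw [heq]
    have h3 : S * (C * B + 1) ≤ C * B * S := by
      have : K - 2 * L = C * B + 1 := by rw [hK]; ring
      rw [this] at h1; linarith
    nlinarith
  refine ⟨1 / (2 * K), by positivity, 4 * B, fun t ht htd x i => ?_⟩
  have hη : (0 : ℝ) < 1 / (2 * (1 + |x|)) := by positivity
  have hη1 : (1 : ℝ) / (2 * (1 + |x|)) < 1 := by
    rw [div_lt_one (by positivity)]; nlinarith [abs_nonneg x]
  have h1 : (1 / (2 * (1 + |x|)) * x) ^ 2 ≤ 1 / 4 := by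
    have : |1 / (2 * (1 + |x|)) * x| ≤ 1 / 2 := by
      rw [abs_mul, abs_of_pos hη, one_div_mul_eq_div, div_le_iff₀ (by positivity)]
      nlinarith [abs_nonneg x]
    rw [← sq_abs]; nlinarith [abs_nonneg (1 / (2 * (1 + |x|)) * x)]
  have h2 : K * (t - a) ≤ 1 / 2 := by
    calc K * (t - a) ≤ K * (1 / (2 * K)) := by gcongr; linarith
      _ = 1 / 2 := by field_simp
  have h3 := main _ hη hη1 t ht x (by linarith) i
  by_contra! hc
  nlinarith

/-- Two-sided (in time) version of `exists_forall_le_of_transport_le`. -/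
theorem exists_forall_le_of_abs_transport_le {ι : Type*} [Finite ι] {a b B C L t₀ : ℝ}
    {g gt gx V : ι → ℝ → ℝ → ℝ} (ht₀ : t₀ ∈ Icc a b) (hB : 1 ≤ B) (hC : 0 ≤ C) (hL : 0 ≤ L)
    (hg : ∀ i, Continuous fun p : ℝ × ℝ => g i p.1 p.2)
    (hgt : ∀ i x, ∀ t ∈ Icc a b, HasDerivWithinAt (fun s => g i s x) (gt i t x) (Icc a b) t)
    (hgx : ∀ i t x, HasDerivAt (g i t) (gx i t x) x)
    (hV : ∀ i, ∀ t ∈ Icc a b, ∀ x, |V i t x| ≤ L)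
    (hineq : ∀ t ∈ Icc a b, ∀ x, ∀ S, 1 ≤ S → (∀ j, g j t x ≤ S) →
      ∀ i, |gt i t x + V i t x * gx i t x| ≤ C * S ^ 2)
    (h0 : ∀ i x, g i t₀ x < B) :
    ∃ δ > 0, ∃ B', ∀ t ∈ Icc a b, |t - t₀| ≤ δ → ∀ x i, g i t x ≤ B' := by
  have hsubr : Icc t₀ b ⊆ Icc a b := Icc_subset_Icc_left ht₀.1
  have hsubl : ∀ s ∈ Icc a t₀, a + t₀ - s ∈ Icc a b := fun s hs =>
    ⟨by linarith [hs.2], by linarith [hs.1, ht₀.2]⟩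
  obtain ⟨δ₁, hδ₁, B₁, h₁⟩ := exists_forall_le_of_transport_le (a := t₀) (b := b) hB hC hL hg
    (fun i x t ht => (hgt i x t (hsubr ht)).mono hsubr) hgx (fun i t ht => hV i t (hsubr ht))
    (fun t ht x S hS hj i => (le_abs_self _).trans (hineq t (hsubr ht) x S hS hj i)) h0
  obtain ⟨δ₂, hδ₂, B₂, h₂⟩ := exists_forall_le_of_transport_le (a := a) (b := t₀)
    (g := fun i s x => g i (a + t₀ - s) x) (gt := fun i s x => -gt i (a + t₀ - s) x)
    (gx := fun i s x => gx i (a + t₀ - s) x) (V := fun i s x => -V i (a + t₀ - s) x) hB hC hL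
    (fun i => by have := hg i; fun_prop)
    (fun i x t ht => by
      have h := (hgt i x _ (hsubl t ht)).scomp t
        ((hasDerivAt_id t).const_sub (a + t₀)).hasDerivWithinAt (fun s hs => hsubl s hs)
      exact h.congr_deriv (by simp))
    (fun i t x => hgx i _ x) (fun i t ht x => by rw [abs_neg]; exact hV i _ (hsubl t ht) x)
    (fun t ht x S hS hj i => by
      have := hineq _ (hsubl t ht) x S hS hj i
      linarith [(abs_le.1 this).1])
    (fun i x => by simpa using h0 i x)
  refine ⟨min δ₁ δ₂, lt_min hδ₁ hδ₂, max B₁ B₂, fun t ht hd x i => ?_⟩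
  have hd' := abs_le.1 hd
  rcases le_total t₀ t with h | h
  · exact (h₁ t ⟨h, ht.2⟩ (by linarith [min_le_left δ₁ δ₂]) x i).trans (le_max_left _ _)
  · have := h₂ (a + t₀ - t) ⟨by linarith, by linarith [ht.1]⟩
      (by linarith [min_le_right δ₁ δ₂]) x i
    simp only [sub_sub_cancel] at this
    exact this.trans (le_max_right _ _)

/-- A function with closed sublevel sets that is constant on every interval on which it is bounded
above is constant.  (Baire category argument.) -/
theorem eq_of_isClosed_sublevel_of_eq_of_bounded {a b : ℝ} (hab : a ≤ b) {f : ℝ → ℝ}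
    (hcl : ∀ c, IsClosed {t | t ∈ Icc a b ∧ f t ≤ c})
    (hf : ∀ s ∈ Icc a b, ∀ t ∈ Icc a b, s ≤ t → (∃ M, ∀ r ∈ Icc s t, f r ≤ M) → f s = f t) :
    f b = f a := by
  set good : Set ℝ := {t | ∃ δ > 0, ∀ s ∈ Icc a b, |s - t| < δ → f s = f t} with hgood
  suffices h : ∀ t ∈ Icc a b, t ∈ good from constant_on_Icc_of_locally_constant hab h
  by_contra! hne
  set bad : Set ℝ := {t | t ∈ Icc a b ∧ t ∉ good} with hbad
  have hgo : ∀ t ∈ Icc a b, t ∈ good → ∃ δ > 0, ∀ s ∈ Icc a b, |s - t| < δ → s ∈ good := by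
    rintro t ht ⟨δ, hδ, h⟩
    refine ⟨δ / 2, half_pos hδ, fun s hs hst => ⟨δ / 2, half_pos hδ, fun r hr hrs => ?_⟩⟩
    rw [h s hs (by linarith), h r hr ?_]
    calc |r - t| = |(r - s) + (s - t)| := by ring_nf
      _ ≤ |r - s| + |s - t| := abs_add_le _ _
      _ < δ := by linarith
  have hbc : IsClosed bad := by
    refine isClosed_of_closure_subset fun t ht => ?_
    have ht' : t ∈ Icc a b := closure_minimal (fun s hs => hs.1) isClosed_Icc ht
    refine ⟨ht', fun hg => ?_⟩
    obtain ⟨δ, hδ, h⟩ := hgo t ht' hg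
    obtain ⟨s, hs, hst⟩ := Metric.mem_closure_iff.1 ht δ hδ
    exact hs.2 (h s hs.1 (by rwa [abs_sub_comm, ← Real.dist_eq]))
  have : CompleteSpace bad := hbc.completeSpace_coe
  have : Nonempty bad := let ⟨t, ht, htg⟩ := hne; ⟨⟨t, ht, htg⟩⟩
  obtain ⟨n, ⟨t₀, ht₀⟩, hint⟩ := nonempty_interior_of_iUnion_of_closed (X := bad)
    (f := fun n : ℕ => {t | f t ≤ n})
    (fun n => by
      have h1 : {t : bad | f t ≤ n} = Subtype.val ⁻¹' {t | t ∈ Icc a b ∧ f t ≤ n} := by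
        ext t; exact ⟨fun h => ⟨t.2.1, h⟩, fun h => h.2⟩
      rw [h1]
      exact (hcl n).preimage continuous_subtype_val)
    (eq_univ_of_forall fun t => mem_iUnion.2 (exists_nat_ge (f t)))
  obtain ⟨ε, hε, hball⟩ := Metric.mem_nhds_iff.1 (mem_interior_iff_mem_nhds.1 hint)
  have hbn : ∀ t ∈ bad, |t - t₀| < ε → f t ≤ n := fun t ht htd =>
    hball (show (⟨t, ht⟩ : bad) ∈ Metric.ball ⟨t₀, ht₀⟩ ε by
      rwa [Metric.mem_ball, Subtype.dist_eq, Real.dist_eq])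
  have hconst : ∀ s t, a ≤ s → s ≤ t → t ≤ b → (∀ r ∈ Icc s t, r ∈ good) → f t = f s := by
    intro s t has hst htb h
    refine constant_on_Icc_of_locally_constant hst fun r hr => ?_
    obtain ⟨δ, hδ, hh⟩ := h r hr
    exact ⟨δ, hδ, fun q hq => hh q ⟨has.trans hq.1, hq.2.trans htb⟩⟩
  have hall : ∀ t ∈ Icc a b, |t - t₀| < ε → f t ≤ n := by
    intro t ht htd
    by_cases htb : t ∈ bad
    · exact hbn t htb htd
    have hgt : t ∈ good := by by_contra h; exact htb ⟨ht, h⟩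
    rcases le_total t₀ t with hle | hle
    · obtain ⟨s, ⟨hs, hst⟩, hmax⟩ := ((isCompact_Icc (a := t₀) (b := t)).inter_left hbc
        |>.exists_isGreatest ⟨t₀, ht₀, le_rfl, hle⟩)
      have hgd : ∀ r ∈ Ioc s t, r ∈ good := by
        intro r hr
        by_contra h
        have := hmax ⟨⟨⟨hs.1.1.trans hr.1.le, hr.2.trans ht.2⟩, h⟩, hst.1.trans hr.1.le, hr.2⟩
        linarith [hr.1]
      have heq : f s = f t := by
        refine hf s hs.1 t ht hst.2 ⟨max (f s) (f t), fun r hr => ?_⟩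
        rcases hr.1.lt_or_eq with h | h
        · rw [← hconst r t (hs.1.1.trans hr.1) hr.2 ht.2
            fun q hq => hgd q ⟨h.trans_le hq.1, hq.2⟩]
          exact le_max_right _ _
        · rw [← h]; exact le_max_left _ _
      rw [← heq]
      refine hbn s hs (lt_of_le_of_lt ?_ htd)
      rw [abs_of_nonneg (by linarith [hst.1]), abs_of_nonneg (by linarith)]
      linarith [hst.2]
    · obtain ⟨s, ⟨hs, hst⟩, hmin⟩ := ((isCompact_Icc (a := t) (b := t₀)).inter_left hbc
        |>.exists_isLeast ⟨t₀, ht₀, hle, le_rfl⟩)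
      have hgd : ∀ r ∈ Ico t s, r ∈ good := by
        intro r hr
        by_contra h
        have := hmin ⟨⟨⟨ht.1.trans hr.1, hr.2.le.trans hs.1.2⟩, h⟩, hr.1, hr.2.le.trans hst.2⟩
        linarith [hr.2]
      have heq : f t = f s := by
        refine hf t ht s hs.1 hst.1 ⟨max (f s) (f t), fun r hr => ?_⟩
        rcases hr.2.lt_or_eq with h | h
        · rw [hconst t r ht.1 hr.1 (hr.2.trans hs.1.2)
            fun q hq => hgd q ⟨hq.1, hq.2.trans_lt h⟩]
          exact le_max_right _ _
        · rw [h]; exact le_max_left _ _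
      rw [heq]
      refine hbn s hs (lt_of_le_of_lt ?_ htd)
      rw [abs_of_nonpos (by linarith [hst.2]), abs_of_nonpos (by linarith)]
      linarith [hst.1]
  refine ht₀.2 ⟨ε, hε, fun s hs hst => ?_⟩
  have hst' := abs_lt.1 hst
  rcases le_total s t₀ with h | h
  · exact hf s hs t₀ ht₀.1 h ⟨n, fun r hr => hall r ⟨hs.1.trans hr.1, hr.2.trans ht₀.1.2⟩
      (abs_lt.2 ⟨by linarith [hr.1], by linarith [hr.2]⟩)⟩
  · exact (hf t₀ ht₀.1 s hs h ⟨n, fun r hr => hall r ⟨ht₀.1.1.trans hr.1, hr.2.trans hs.2⟩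
      (abs_lt.2 ⟨by linarith [hr.1], by linarith [hr.2]⟩)⟩).symm

/-- Convolution against an exponentially decaying kernel is controlled by the sup norm and the
`L¹` norm of the two parts of the integrand. -/
theorem abs_intervalIntegral_kernel_le {L k W ε : ℝ} {κ v w : ℝ → ℝ} (hL : 0 ≤ L) (hk : 0 ≤ k)
    (hε : |ε| ≤ 1) (hκ : ∀ z ∈ Icc 0 L, |κ z| ≤ rexp (-z)) (hv : ∀ y, |v y| ≤ k + w y)
    (hw : Continuous w) (hw0 : ∀ y, 0 ≤ w y) (hwi : Integrable w) (hW : ∫ y, w y ≤ W) (x : ℝ) :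
    |∫ z in (0:ℝ)..L, κ z * (v (x + z) + ε * v (x - z))| ≤ 2 * k + 2 * W := by
  have h1 : ‖∫ z in (0:ℝ)..L, κ z * (v (x + z) + ε * v (x - z))‖ ≤
      ∫ z in (0:ℝ)..L, (rexp (-z) * (2 * k) + (w (x + z) + w (x - z))) := by
    refine intervalIntegral.norm_integral_le_of_norm_le hL (Eventually.of_forall fun z hz => ?_)
      ((by fun_prop : Continuous _).intervalIntegrable _ _)
    have he : rexp (-z) ≤ 1 := exp_le_one_iff.2 (by linarith [hz.1])
    have h2 : |v (x + z) + ε * v (x - z)| ≤ (k + w (x + z)) + (k + w (x - z)) := by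
      refine (abs_add_le _ _).trans (add_le_add (hv _) ?_)
      rw [abs_mul]
      exact (mul_le_of_le_one_left (abs_nonneg _) hε).trans (hv _)
    rw [norm_mul, norm_eq_abs, norm_eq_abs]
    have := mul_le_mul (hκ z ⟨hz.1.le, hz.2⟩) h2 (abs_nonneg _) (exp_pos _).le
    nlinarith [hw0 (x + z), hw0 (x - z)]
  have hle : ∀ c d : ℝ, c ≤ d → ∫ y in c..d, w y ≤ W := fun c d hcd => by
    rw [intervalIntegral.integral_of_le hcd]
    exact (setIntegral_le_integral hwi (Eventually.of_forall hw0)).trans hW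
  have h2 : ∫ z in (0:ℝ)..L, (rexp (-z) * (2 * k) + (w (x + z) + w (x - z))) =
      (1 - rexp (-L)) * (2 * k) + ((∫ y in x..x + L, w y) + ∫ y in x - L..x, w y) := by
    rw [intervalIntegral.integral_add ((by fun_prop : Continuous _).intervalIntegrable _ _)
      ((by fun_prop : Continuous _).intervalIntegrable _ _),
      intervalIntegral.integral_add ((by fun_prop : Continuous _).intervalIntegrable _ _)
      ((by fun_prop : Continuous _).intervalIntegrable _ _), intervalIntegral.integral_mul_const,
      intervalIntegral.integral_comp_add_left, intervalIntegral.integral_comp_sub_left,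
      intervalIntegral.integral_comp_neg (fun z => rexp z)]
    simp
  rw [h2] at h1
  have := mul_nonneg (exp_pos (-L)).le hk
  rw [norm_eq_abs] at h1
  linarith [hle x (x + L) (by linarith), hle (x - L) x (by linarith)]

/-- The triangular average `∫₀¹ (1 - z) (h(x + z) + h(x - z)) dz`. -/
noncomputable def evenTent (h : ℝ → ℝ) (x : ℝ) : ℝ :=
  ∫ z in (0:ℝ)..1, (1 - z) * (h (x + z) + h (x - z))

/-- The odd kernel operator `½ ∫₀¹ (1 - z)² (h(x + z) - h(x - z)) dz`. -/
noncomputable def oddTent (h : ℝ → ℝ) (x : ℝ) : ℝ :=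
  ∫ z in (0:ℝ)..1, (1 - z) ^ 2 / 2 * (h (x + z) - h (x - z))

theorem hasDerivAt_comp_add_sub {h h' : ℝ → ℝ} (hd : ∀ x, HasDerivAt h (h' x) x) (ε x z : ℝ) :
    HasDerivAt (fun z => h (x + z) + ε * h (x - z)) (h' (x + z) - ε * h' (x - z)) z := by
  have h1 : HasDerivAt (fun z => h (x + z)) (h' (x + z)) z := (hd _).comp_const_add _ _
  have h2 : HasDerivAt (fun z => h (x - z)) (-h' (x - z)) z := (hd _).comp_const_sub _ _
  exact (h1.add (h2.const_mul ε)).congr_deriv (by ring)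

theorem oddTent_deriv {h h' : ℝ → ℝ} (hd : ∀ x, HasDerivAt h (h' x) x) (hc : Continuous h')
    (x : ℝ) : oddTent h' x = -h x + evenTent h x := by
  have hh : Continuous h := continuous_iff_continuousAt.2 fun x => (hd x).continuousAt
  have key : ∀ z, HasDerivAt (fun z => (1 - z) ^ 2 / 2 * (h (x + z) + 1 * h (x - z)))
      ((1 - z) ^ 2 / 2 * (h' (x + z) - h' (x - z)) - (1 - z) * (h (x + z) + h (x - z))) z := by
    intro z
    have := ((((hasDerivAt_id z).const_sub 1).fun_pow 2).div_const 2).mul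
      (hasDerivAt_comp_add_sub hd 1 x z)
    exact this.congr_deriv (by simp; ring)
  have := intervalIntegral.integral_eq_sub_of_hasDerivAt (a := 0) (b := 1) (fun z _ => key z)
    ((by fun_prop : Continuous _).intervalIntegrable _ _)
  rw [intervalIntegral.integral_sub ((by fun_prop : Continuous _).intervalIntegrable _ _)
    ((by fun_prop : Continuous _).intervalIntegrable _ _)] at this
  simp only [oddTent, evenTent]
  simp at this
  linarith

theorem evenTent_deriv_deriv {h h' h'' : ℝ → ℝ} (hd : ∀ x, HasDerivAt h (h' x) x)
    (hd' : ∀ x, HasDerivAt h' (h'' x) x) (hc : Continuous h'') (x : ℝ) :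
    evenTent h'' x = h (x + 1) - 2 * h x + h (x - 1) := by
  have hh : Continuous h := continuous_iff_continuousAt.2 fun x => (hd x).continuousAt
  have hh' : Continuous h' := continuous_iff_continuousAt.2 fun x => (hd' x).continuousAt
  have key : ∀ z, HasDerivAt (fun z => (1 - z) * (h' (x + z) + (-1) * h' (x - z)) +
      (h (x + z) + 1 * h (x - z))) ((1 - z) * (h'' (x + z) + h'' (x - z))) z := by
    intro z
    have := (((hasDerivAt_id z).const_sub 1).mul (hasDerivAt_comp_add_sub hd' (-1) x z)).add
      (hasDerivAt_comp_add_sub hd 1 x z)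
    exact this.congr_deriv (by simp; ring)
  have := intervalIntegral.integral_eq_sub_of_hasDerivAt (a := 0) (b := 1) (fun z _ => key z)
    ((by fun_prop : Continuous _).intervalIntegrable _ _)
  simp only [evenTent]
  simp at this
  linarith

theorem abs_evenTent_le {k W : ℝ} {v w : ℝ → ℝ} (hk : 0 ≤ k) (hv : ∀ y, |v y| ≤ k + w y)
    (hw : Continuous w) (hw0 : ∀ y, 0 ≤ w y) (hwi : Integrable w) (hW : ∫ y, w y ≤ W) (x : ℝ) :
    |evenTent v x| ≤ 2 * k + 2 * W := by
  have := abs_intervalIntegral_kernel_le (κ := fun z => 1 - z) (ε := 1) zero_le_one hk (by simp)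
    (fun z hz => by
      rw [abs_of_nonneg (by linarith [hz.2])]
      linarith [add_one_le_exp (-z)]) hv hw hw0 hwi hW x
  simpa [evenTent] using this

theorem abs_oddTent_le {k W : ℝ} {v w : ℝ → ℝ} (hk : 0 ≤ k) (hv : ∀ y, |v y| ≤ k + w y)
    (hw : Continuous w) (hw0 : ∀ y, 0 ≤ w y) (hwi : Integrable w) (hW : ∫ y, w y ≤ W) (x : ℝ) :
    |oddTent v x| ≤ 2 * k + 2 * W := by
  have := abs_intervalIntegral_kernel_le (κ := fun z => (1 - z) ^ 2 / 2) (ε := -1) zero_le_one hk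
    (by simp)
    (fun z hz => by
      rw [abs_of_nonneg (by positivity)]
      nlinarith [add_one_le_exp (-z), hz.1, hz.2]) hv hw hw0 hwi hW x
  simpa [oddTent, sub_eq_add_neg] using this

theorem evenTent_add {v w : ℝ → ℝ} (hv : Continuous v) (hw : Continuous w) (x : ℝ) :
    evenTent (fun y => v y + w y) x = evenTent v x + evenTent w x := by
  simp only [evenTent]
  rw [← intervalIntegral.integral_add ((by fun_prop : Continuous _).intervalIntegrable _ _)
    ((by fun_prop : Continuous _).intervalIntegrable _ _)]
  congr 1; ext z; ring

theorem oddTent_add {v w : ℝ → ℝ} (hv : Continuous v) (hw : Continuous w) (x : ℝ) :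
    oddTent (fun y => v y + w y) x = oddTent v x + oddTent w x := by
  simp only [oddTent]
  rw [← intervalIntegral.integral_add ((by fun_prop : Continuous _).intervalIntegrable _ _)
    ((by fun_prop : Continuous _).intervalIntegrable _ _)]
  congr 1; ext z; ring

theorem evenTent_const_mul (k : ℝ) (v : ℝ → ℝ) (x : ℝ) :
    evenTent (fun y => k * v y) x = k * evenTent v x := by
  simp only [evenTent]
  rw [← intervalIntegral.integral_const_mul]
  congr 1; ext z; ring

theorem oddTent_const_mul (k : ℝ) (v : ℝ → ℝ) (x : ℝ) :
    oddTent (fun y => k * v y) x = k * oddTent v x := by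
  simp only [oddTent]
  rw [← intervalIntegral.integral_const_mul]
  congr 1; ext z; ring

/-- The Green kernel of `1 - ∂ₓ²` on `[0, L]` with a Dirichlet condition at `L`. -/
noncomputable def greenKernel (L z : ℝ) : ℝ := sinh (L - z) / (2 * cosh L)

/-- The derivative of `greenKernel`. -/
noncomputable def greenKernelDeriv (L z : ℝ) : ℝ := -cosh (L - z) / (2 * cosh L)

theorem hasDerivAt_greenKernel (L z : ℝ) :
    HasDerivAt (greenKernel L) (greenKernelDeriv L z) z := by
  have := ((hasDerivAt_sinh (L - z)).comp_const_sub L z).div_const (2 * cosh L)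
  exact this.congr_deriv (by simp [greenKernelDeriv])

theorem hasDerivAt_greenKernelDeriv (L z : ℝ) :
    HasDerivAt (greenKernelDeriv L) (greenKernel L z) z := by
  have := ((hasDerivAt_cosh (L - z)).comp_const_sub L z).fun_neg.div_const (2 * cosh L)
  exact this.congr_deriv (by simp [greenKernel])

@[fun_prop]
theorem continuous_greenKernel (L : ℝ) : Continuous (greenKernel L) :=
  continuous_iff_continuousAt.2 fun z => (hasDerivAt_greenKernel L z).continuousAt

@[fun_prop]
theorem continuous_greenKernelDeriv (L : ℝ) : Continuous (greenKernelDeriv L) :=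
  continuous_iff_continuousAt.2 fun z => (hasDerivAt_greenKernelDeriv L z).continuousAt

theorem greenKernel_self (L : ℝ) : greenKernel L L = 0 := by simp [greenKernel]

theorem greenKernelDeriv_self (L : ℝ) : greenKernelDeriv L L = -(1 / (2 * cosh L)) := by
  simp [greenKernelDeriv, neg_div]

theorem greenKernelDeriv_zero (L : ℝ) : greenKernelDeriv L 0 = -(1 / 2) := by
  have := (cosh_pos L).ne'
  simp only [greenKernelDeriv, sub_zero]
  field_simp

theorem abs_greenKernelDeriv_le {L z : ℝ} (hz : z ∈ Icc 0 L) :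
    |greenKernelDeriv L z| ≤ rexp (-z) := by
  have h1 : cosh (L - z) ≤ rexp (L - z) := by
    rw [cosh_eq]
    linarith [exp_le_exp.2 (by linarith [hz.2] : -(L - z) ≤ L - z)]
  have h2 : rexp L ≤ 2 * cosh L := by
    rw [cosh_eq]
    linarith [exp_pos (-L)]
  have h3 : rexp (L - z) = rexp (-z) * rexp L := by rw [← exp_add]; congr 1; ring
  rw [greenKernelDeriv, abs_div, abs_neg, abs_of_pos (cosh_pos _),
    abs_of_pos (by linarith [cosh_pos L] : 0 < 2 * cosh L), div_le_iff₀ (by linarith [cosh_pos L])]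
  rw [h3] at h1
  exact h1.trans (mul_le_mul_of_nonneg_left h2 (exp_pos _).le)

theorem abs_greenKernel_le {L z : ℝ} (hz : z ∈ Icc 0 L) : |greenKernel L z| ≤ rexp (-z) := by
  refine le_trans ?_ (abs_greenKernelDeriv_le hz)
  rw [greenKernel, greenKernelDeriv, abs_div, abs_div, abs_neg]
  refine div_le_div_of_nonneg_right ?_ (abs_nonneg _)
  rw [abs_of_nonneg (sinh_nonneg_iff.2 (by linarith [hz.2])), abs_of_pos (cosh_pos _)]
  exact (sinh_lt_cosh _).le

theorem integral_greenKernel_momentum {φ φ' φ'' : ℝ → ℝ} (hd : ∀ x, HasDerivAt φ (φ' x) x)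
    (hd' : ∀ x, HasDerivAt φ' (φ'' x) x) (hc : Continuous φ'') (L x : ℝ) :
    ∫ z in (0:ℝ)..L, greenKernel L z * ((φ (x + z) - φ'' (x + z)) + (φ (x - z) - φ'' (x - z))) =
      φ x - (φ (x + L) + φ (x - L)) / (2 * cosh L) := by
  have hh : Continuous φ := continuous_iff_continuousAt.2 fun x => (hd x).continuousAt
  have hh' : Continuous φ' := continuous_iff_continuousAt.2 fun x => (hd' x).continuousAt
  have key : ∀ z, HasDerivAt (fun z => greenKernelDeriv L z * (φ (x + z) + 1 * φ (x - z))
      - greenKernel L z * (φ' (x + z) + (-1) * φ' (x - z)))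
      (greenKernel L z * ((φ (x + z) - φ'' (x + z)) + (φ (x - z) - φ'' (x - z)))) z := fun z =>
    (((hasDerivAt_greenKernelDeriv L z).mul (hasDerivAt_comp_add_sub hd 1 x z)).sub
      ((hasDerivAt_greenKernel L z).mul
        (hasDerivAt_comp_add_sub hd' (-1) x z))).congr_deriv (by ring)
  rw [intervalIntegral.integral_eq_sub_of_hasDerivAt (fun z _ => key z)
    ((by fun_prop : Continuous _).intervalIntegrable _ _)]
  simp only [greenKernel_self, greenKernelDeriv_self, greenKernelDeriv_zero]
  simp
  ring

theorem integral_greenKernel_flux {P P' Y Y' Y'' S : ℝ → ℝ} (hP : ∀ x, HasDerivAt P (P' x) x)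
    (hY : ∀ x, HasDerivAt Y (Y' x) x) (hY' : ∀ x, HasDerivAt Y' (Y'' x) x) (hc : Continuous P')
    (hc' : Continuous Y'') (hS : Continuous S) (L x : ℝ) :
    ∫ z in (0:ℝ)..L, greenKernel L z * ((P' (x + z) + Y'' (x + z) + S (x + z))
        + (P' (x - z) + Y'' (x - z) + S (x - z))) =
      -Y x + (Y (x + L) + Y (x - L)) / (2 * cosh L)
        + ((∫ z in (0:ℝ)..L, greenKernel L z * ((Y (x + z) + S (x + z))
            + 1 * (Y (x - z) + S (x - z))))
        - ∫ z in (0:ℝ)..L, greenKernelDeriv L z * (P (x + z) + (-1) * P (x - z))) := by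
  have := (continuous_iff_continuousAt.2 fun x => (hP x).continuousAt : Continuous P)
  have := (continuous_iff_continuousAt.2 fun x => (hY x).continuousAt : Continuous Y)
  have := (continuous_iff_continuousAt.2 fun x => (hY' x).continuousAt : Continuous Y')
  have key : ∀ z, HasDerivAt (fun z => greenKernel L z * (P (x + z) + (-1) * P (x - z))
      + greenKernel L z * (Y' (x + z) + (-1) * Y' (x - z))
      - greenKernelDeriv L z * (Y (x + z) + 1 * Y (x - z)))
      (greenKernel L z * ((P' (x + z) + Y'' (x + z) + S (x + z))
        + (P' (x - z) + Y'' (x - z) + S (x - z)))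
        - (greenKernel L z * ((Y (x + z) + S (x + z)) + 1 * (Y (x - z) + S (x - z)))
          - greenKernelDeriv L z * (P (x + z) + (-1) * P (x - z)))) z := fun z =>
    ((((hasDerivAt_greenKernel L z).mul (hasDerivAt_comp_add_sub hP (-1) x z)).add
      ((hasDerivAt_greenKernel L z).mul
        (hasDerivAt_comp_add_sub hY' (-1) x z))).sub
      ((hasDerivAt_greenKernelDeriv L z).mul
        (hasDerivAt_comp_add_sub hY 1 x z))).congr_deriv (by ring)
  have h1 := intervalIntegral.integral_eq_sub_of_hasDerivAt (a := 0) (b := L) (fun z _ => key z)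
    ((by fun_prop : Continuous _).intervalIntegrable _ _)
  rw [intervalIntegral.integral_sub ((by fun_prop : Continuous _).intervalIntegrable _ _)
    ((by fun_prop : Continuous _).intervalIntegrable _ _),
    intervalIntegral.integral_sub ((by fun_prop : Continuous _).intervalIntegrable _ _)
    ((by fun_prop : Continuous _).intervalIntegrable _ _)] at h1
  simp only [greenKernel_self, greenKernelDeriv_self, greenKernelDeriv_zero] at h1
  rw [← sub_eq_iff_eq_add, h1]
  simp
  ring

theorem abs_integral_greenKernel_flux_le {P P' Y Y' Y'' S : ℝ → ℝ} {D L : ℝ}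
    (hP : ∀ x, HasDerivAt P (P' x) x)
    (hY : ∀ x, HasDerivAt Y (Y' x) x) (hY' : ∀ x, HasDerivAt Y' (Y'' x) x) (hc : Continuous P')
    (hc' : Continuous Y'') (hS : Continuous S) (hPD : ∀ x, |P x| ≤ D) (hYD : ∀ x, |Y x| ≤ D)
    (hSD : ∀ x, |S x| ≤ D) (hL : 0 ≤ L) (x : ℝ) :
    |∫ z in (0:ℝ)..L, greenKernel L z * ((P' (x + z) + Y'' (x + z) + S (x + z))
        + (P' (x - z) + Y'' (x - z) + S (x - z)))| ≤ 8 * D := by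
  have hD : 0 ≤ D := (abs_nonneg _).trans (hPD 0)
  rw [integral_greenKernel_flux hP hY hY' hc hc' hS]
  have h1 := abs_intervalIntegral_kernel_le (k := D) (W := 0) (ε := -1) (w := fun _ => 0)
    hL hD (by simp) (fun z hz => abs_greenKernelDeriv_le hz) (by simpa using hPD) continuous_const
    (fun _ => le_rfl) (by simp) (by simp) x
  have h2 := abs_intervalIntegral_kernel_le (k := D + D) (W := 0) (ε := 1)
    (v := fun y => Y y + S y) (w := fun _ => 0)
    hL (by positivity) (by simp) (fun z hz => abs_greenKernel_le hz)
    (fun y => by simpa using (abs_add_le _ _).trans (add_le_add (hYD y) (hSD y)))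
    continuous_const (fun _ => le_rfl) (by simp) (by simp) x
  have h3 : |(Y (x + L) + Y (x - L)) / (2 * cosh L)| ≤ D := by
    rw [abs_div, div_le_iff₀ (abs_pos.2 (by linarith [cosh_pos L])),
      abs_of_pos (by linarith [cosh_pos L] : 0 < 2 * cosh L)]
    have := (abs_add_le _ _).trans (add_le_add (hYD (x + L)) (hYD (x - L)))
    nlinarith [one_le_cosh L]
  have h4 := hYD x
  rw [abs_le] at *
  constructor <;> linarith

theorem abs_mul_le_mul {x y X Y : ℝ} (hx : |x| ≤ X) (hy : |y| ≤ Y) : |x * y| ≤ X * Y := by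
  rw [abs_mul]
  exact mul_le_mul hx hy (abs_nonneg _) ((abs_nonneg _).trans hx)

theorem hasDerivAt_cutoff (R x : ℝ) : HasDerivAt (fun x => (1 - (x / R) ^ 2) ^ 3)
    (-6 * (x / R) / R * (1 - (x / R) ^ 2) ^ 2) x := by
  have := ((((hasDerivAt_id x).div_const R).fun_pow 2).const_sub 1).fun_pow 3
  exact this.congr_deriv (by simp; ring)

theorem hasDerivAt_cutoff_deriv (R x : ℝ) :
    HasDerivAt (fun x => -6 * (x / R) / R * (1 - (x / R) ^ 2) ^ 2)
      ((-6 * (1 - (x / R) ^ 2) ^ 2 + 24 * (x / R) ^ 2 * (1 - (x / R) ^ 2)) / R ^ 2) x := by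
  have h1 := (hasDerivAt_id x).div_const R
  have := ((h1.const_mul (-6)).div_const R).mul (((h1.fun_pow 2).const_sub 1).fun_pow 2)
  exact this.congr_deriv (by simp; ring)

theorem abs_div_le_one_of_mem {R x : ℝ} (hR : 1 ≤ R) (hx : x ∈ Icc (-R) R) : |x / R| ≤ 1 := by
  rw [abs_div, abs_of_pos (by linarith : 0 < R), div_le_one (by linarith)]
  exact abs_le.2 ⟨hx.1, hx.2⟩

theorem abs_cutoff_deriv_le {R x : ℝ} (hR : 1 ≤ R) (hx : x ∈ Icc (-R) R) :
    |-6 * (x / R) / R * (1 - (x / R) ^ 2) ^ 2| ≤ 30 / R := by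
  have h1 := abs_div_le_one_of_mem hR hx
  have h2 := sq_le_sq' (abs_le.1 h1).1 (abs_le.1 h1).2
  have h3 : |-6 * (x / R) * (1 - (x / R) ^ 2) ^ 2| ≤ 30 * 1 := by
    refine abs_mul_le_mul (X := 30) ?_ ?_
    · rw [abs_mul]
      norm_num
      linarith
    · rw [abs_sq]
      nlinarith [sq_nonneg (x / R)]
  calc _ = |-6 * (x / R) * (1 - (x / R) ^ 2) ^ 2 / R| := by congr 1; ring
    _ = |-6 * (x / R) * (1 - (x / R) ^ 2) ^ 2| / R := by
      rw [abs_div, abs_of_pos (by linarith : 0 < R)]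
    _ ≤ _ := div_le_div_of_nonneg_right (by linarith) (by linarith)

theorem abs_cutoff_deriv_deriv_le {R x : ℝ} (hR : 1 ≤ R) (hx : x ∈ Icc (-R) R) :
    |(-6 * (1 - (x / R) ^ 2) ^ 2 + 24 * (x / R) ^ 2 * (1 - (x / R) ^ 2)) / R ^ 2| ≤ 30 / R := by
  have h1 := abs_div_le_one_of_mem hR hx
  have h2 := sq_le_sq' (abs_le.1 h1).1 (abs_le.1 h1).2
  rw [abs_div, abs_of_pos (by positivity : 0 < R ^ 2)]
  refine div_le_div₀ (by norm_num) ?_ (by linarith) (by nlinarith)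
  rw [abs_le]
  constructor <;> nlinarith [sq_nonneg (x / R), sq_nonneg ((x / R) ^ 2)]

theorem tendsto_integral_mul_cutoff {e : ℝ → ℝ} (he : Integrable e) :
    Tendsto (fun n : ℕ => ∫ x in -((n : ℝ) + 1) ^ 2..((n : ℝ) + 1) ^ 2,
      e x * (1 - (x / ((n : ℝ) + 1) ^ 2) ^ 2) ^ 3) atTop (𝓝 (∫ x, e x)) := by
  have hR : Tendsto (fun n : ℕ => ((n : ℝ) + 1) ^ 2) atTop atTop :=
    (tendsto_pow_atTop two_ne_zero).comp
      (tendsto_atTop_add_const_right _ 1 tendsto_natCast_atTop_atTop)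
  have h1 : ∀ n : ℕ, 1 ≤ ((n : ℝ) + 1) ^ 2 := fun n => one_le_pow₀ (by simp)
  have hI : ∀ n : ℕ, ∫ x in -((n : ℝ) + 1) ^ 2..((n : ℝ) + 1) ^ 2,
      e x * (1 - (x / ((n : ℝ) + 1) ^ 2) ^ 2) ^ 3 =
      ∫ x, (Ioc (-((n : ℝ) + 1) ^ 2) (((n : ℝ) + 1) ^ 2)).indicator
        (fun x => e x * (1 - (x / ((n : ℝ) + 1) ^ 2) ^ 2) ^ 3) x := fun n => by
    rw [intervalIntegral.integral_of_le (by linarith [h1 n]), integral_indicator measurableSet_Ioc]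
  simp_rw [hI]
  refine tendsto_integral_of_dominated_convergence (fun x => ‖e x‖) (fun n => ?_) he.norm
    (fun n => Eventually.of_forall fun x => ?_) (Eventually.of_forall fun x => ?_)
  · exact (he.aestronglyMeasurable.mul
      (by fun_prop : Continuous _).aestronglyMeasurable).indicator measurableSet_Ioc
  · by_cases hx : x ∈ Ioc (-((n : ℝ) + 1) ^ 2) (((n : ℝ) + 1) ^ 2)
    · rw [indicator_of_mem hx, norm_mul]
      refine mul_le_of_le_one_right (norm_nonneg _) ?_
      have h2 := abs_div_le_one_of_mem (h1 n) (Ioc_subset_Icc_self hx)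
      have h3 := sq_le_sq' (abs_le.1 h2).1 (abs_le.1 h2).2
      rw [norm_eq_abs, abs_pow]
      refine pow_le_one₀ (abs_nonneg _) (abs_le.2 ⟨by linarith, ?_⟩)
      linarith [sq_nonneg (x / ((n : ℝ) + 1) ^ 2)]
    · rw [indicator_of_notMem hx]
      simp
  · have h2 : Tendsto (fun n : ℕ => e x * (1 - (x / ((n : ℝ) + 1) ^ 2) ^ 2) ^ 3) atTop
        (𝓝 (e x * (1 - 0 ^ 2) ^ 3)) :=
      (((((tendsto_const_nhds.div_atTop hR).pow 2).const_sub 1).pow 3).const_mul (e x))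
    have h3 : ∀ᶠ n : ℕ in atTop, e x * (1 - (x / ((n : ℝ) + 1) ^ 2) ^ 2) ^ 3 =
        (Ioc (-((n : ℝ) + 1) ^ 2) (((n : ℝ) + 1) ^ 2)).indicator
        (fun x => e x * (1 - (x / ((n : ℝ) + 1) ^ 2) ^ 2) ^ 3) x := by
      filter_upwards [hR.eventually_gt_atTop |x|] with n hn
      have hx : x ∈ Ioc (-((n : ℝ) + 1) ^ 2) (((n : ℝ) + 1) ^ 2) :=
        ⟨(abs_lt.1 hn).1, (abs_lt.1 hn).2.le⟩
      rw [indicator_of_mem hx]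
    simpa using h2.congr' h3

theorem continuous_oddTent {g : ℝ → ℝ → ℝ} (hg : Continuous fun p : ℝ × ℝ => g p.1 p.2) :
    Continuous fun p : ℝ × ℝ => oddTent (g p.1) p.2 := by
  have h : Continuous fun q : (ℝ × ℝ) × ℝ =>
      (1 - q.2) ^ 2 / 2 * (g q.1.1 (q.1.2 + q.2) - g q.1.1 (q.1.2 - q.2)) := by fun_prop
  exact intervalIntegral.continuous_parametric_intervalIntegral_of_continuous'
    (f := fun (p : ℝ × ℝ) z => (1 - z) ^ 2 / 2 * (g p.1 (p.2 + z) - g p.1 (p.2 - z))) h _ _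

theorem hasDerivAt_oddTent {h h' : ℝ → ℝ} (hd : ∀ x, HasDerivAt h (h' x) x) (hc : Continuous h')
    (x : ℝ) : HasDerivAt (oddTent h) (oddTent h' x) x := by
  have hh : Continuous h := continuous_iff_continuousAt.2 fun x => (hd x).continuousAt
  refine hasDerivAt_intervalIntegral zero_le_one
    (F := fun x z => (1 - z) ^ 2 / 2 * (h (x + z) - h (x - z)))
    (F' := fun x z => (1 - z) ^ 2 / 2 * (h' (x + z) - h' (x - z))) (fun x => by fun_prop)
    (by fun_prop) (fun z x => ?_) x
  exact (((hd (x + z)).comp_add_const x z).sub ((hd (x - z)).comp_sub_const x z)).const_mul _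

theorem hasDerivWithinAt_oddTent {a b : ℝ} {g gt : ℝ → ℝ → ℝ}
    (hg : Continuous fun p : ℝ × ℝ => g p.1 p.2) (hgt : Continuous fun p : ℝ × ℝ => gt p.1 p.2)
    (hd : ∀ x, ∀ t ∈ Icc a b, HasDerivWithinAt (fun s => g s x) (gt t x) (Icc a b) t) (x : ℝ) :
    ∀ t ∈ Icc a b, HasDerivWithinAt (fun s => oddTent (g s) x) (oddTent (gt t) x) (Icc a b) t :=
  hasDerivWithinAt_intervalIntegral zero_le_one
    (F := fun t z => (1 - z) ^ 2 / 2 * (g t (x + z) - g t (x - z)))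
    (F' := fun t z => (1 - z) ^ 2 / 2 * (gt t (x + z) - gt t (x - z))) (fun x => by fun_prop)
    (by fun_prop) (fun z t ht => ((hd _ t ht).sub (hd _ t ht)).const_mul _)

/-- The R2CH system on the closed strip `[a, b] × ℝ`, with all spatial derivatives and the time
derivatives `ut = ∂ₜu`, `vt = ∂ₜ∂ₓ²u`, `rt = ∂ₜρ` named explicitly. The fields are extended to all
times, and only the time derivatives refer to `[a, b]`. -/
structure R2CHStrip (A μ σ Ω c a b : ℝ) (u u1 u2 u3 ut vt r r1 rt : ℝ → ℝ → ℝ) : Prop where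
  du : ∀ t x, HasDerivAt (u t) (u1 t x) x
  du1 : ∀ t x, HasDerivAt (u1 t) (u2 t x) x
  du2 : ∀ t x, HasDerivAt (u2 t) (u3 t x) x
  dr : ∀ t x, HasDerivAt (r t) (r1 t x) x
  cu : Continuous fun p : ℝ × ℝ => u p.1 p.2
  cu1 : Continuous fun p : ℝ × ℝ => u1 p.1 p.2
  cu2 : Continuous fun p : ℝ × ℝ => u2 p.1 p.2
  cu3 : Continuous fun p : ℝ × ℝ => u3 p.1 p.2
  cut : Continuous fun p : ℝ × ℝ => ut p.1 p.2
  cvt : Continuous fun p : ℝ × ℝ => vt p.1 p.2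
  cr : Continuous fun p : ℝ × ℝ => r p.1 p.2
  cr1 : Continuous fun p : ℝ × ℝ => r1 p.1 p.2
  crt : Continuous fun p : ℝ × ℝ => rt p.1 p.2
  tu : ∀ x, ∀ t ∈ Icc a b, HasDerivWithinAt (fun s => u s x) (ut t x) (Icc a b) t
  tu2 : ∀ x, ∀ t ∈ Icc a b, HasDerivWithinAt (fun s => u2 s x) (vt t x) (Icc a b) t
  tr : ∀ x, ∀ t ∈ Icc a b, HasDerivWithinAt (fun s => r s x) (rt t x) (Icc a b) t
  eq_u : ∀ t x, ut t x - vt t x = A * u1 t x - 3 * u t x * u1 t x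
    + σ * (2 * u1 t x * u2 t x + u t x * u3 t x) - μ * u3 t x - c * r t x * r1 t x
    + 2 * Ω * r t x * (r1 t x * u t x + r t x * u1 t x)
  eq_r : ∀ t x, rt t x = -(u1 t x * r t x + u t x * r1 t x)
  iu : ∀ t, Integrable fun x => u t x ^ 2
  iu1 : ∀ t, Integrable fun x => u1 t x ^ 2
  iu2 : ∀ t, Integrable fun x => u2 t x ^ 2
  ir : ∀ t, Integrable fun x => (r t x - 1) ^ 2
  lu : ∀ t, Tendsto (u t) atBot (𝓝 0)
  lu1 : ∀ t, Tendsto (u1 t) atBot (𝓝 0)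
  br : ∀ t, ∃ B, ∀ x, |r t x - 1| ≤ B

namespace R2CHStrip

variable {A μ σ Ω c a b M : ℝ} {u u1 u2 u3 ut vt r r1 rt : ℝ → ℝ → ℝ}

theorem mono {a' b' : ℝ} (h : R2CHStrip A μ σ Ω c a b u u1 u2 u3 ut vt r r1 rt) (ha : a ≤ a')
    (hb : b' ≤ b) : R2CHStrip A μ σ Ω c a' b' u u1 u2 u3 ut vt r r1 rt :=
  have hs : Icc a' b' ⊆ Icc a b := Icc_subset_Icc ha hb
  { h with
    tu := fun x t ht => (h.tu x t (hs ht)).mono hs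
    tu2 := fun x t ht => (h.tu2 x t (hs ht)).mono hs
    tr := fun x t ht => (h.tr x t (hs ht)).mono hs }

/-- The tent-averaged momentum `oddTent (u - u_xx + Ω (ρ² - 1))` differs from `u_x` by terms
controlled by the energy. -/
theorem oddTent_momentum (h : R2CHStrip A μ σ Ω c a b u u1 u2 u3 ut vt r r1 rt) (t x : ℝ) :
    oddTent (fun y => u t y - u2 t y + Ω * (r t y ^ 2 - 1)) x = u1 t x +
      (oddTent (u t) x - evenTent (u1 t) x + Ω * oddTent (fun y => r t y ^ 2 - 1) x) := by
  have := h.cu; have := h.cu2; have := h.cr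
  have e : (fun y => u t y - u2 t y + Ω * (r t y ^ 2 - 1)) =
      fun y => (u t y + (-1) * u2 t y) + Ω * (r t y ^ 2 - 1) := by ext; ring
  rw [e, oddTent_add (by fun_prop) (by fun_prop), oddTent_add (by fun_prop) (by fun_prop),
    oddTent_const_mul, oddTent_const_mul, oddTent_deriv (h.du1 t) (by fun_prop)]
  ring

/-- The spatial derivative of the tent-averaged momentum. -/
theorem hasDerivAt_oddTent_momentum (h : R2CHStrip A μ σ Ω c a b u u1 u2 u3 ut vt r r1 rt)
    (t x : ℝ) :
    HasDerivAt (oddTent fun y => u t y - u2 t y + Ω * (r t y ^ 2 - 1))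
      (-(u t x - u2 t x + Ω * (r t x ^ 2 - 1)) + (evenTent (u t) x
        + Ω * evenTent (fun y => r t y ^ 2 - 1) x - (u t (x + 1) - 2 * u t x + u t (x - 1)))) x := by
  have := h.cu; have := h.cu1; have := h.cu2; have := h.cu3; have := h.cr; have := h.cr1
  have hd : ∀ x, HasDerivAt (fun y => u t y - u2 t y + Ω * (r t y ^ 2 - 1))
      (u1 t x - u3 t x + Ω * (2 * r t x * r1 t x)) x := fun x =>
    (((h.du t x).sub (h.du2 t x)).add ((((h.dr t x).fun_pow 2).sub_const 1).const_mul Ω)).congr_deriv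
      (by simp)
  refine (hasDerivAt_oddTent hd (by fun_prop) x).congr_deriv ?_
  rw [oddTent_deriv hd (by fun_prop)]
  have e : (fun y => u t y - u2 t y + Ω * (r t y ^ 2 - 1)) =
      fun y => (u t y + (-1) * u2 t y) + Ω * (r t y ^ 2 - 1) := by ext; ring
  rw [e, evenTent_add (by fun_prop) (by fun_prop), evenTent_add (by fun_prop) (by fun_prop),
    evenTent_const_mul, evenTent_const_mul, evenTent_deriv_deriv (h.du t) (h.du1 t) (by fun_prop)]
  ring

/-- The time derivative of the tent-averaged momentum. -/
theorem hasDerivWithinAt_oddTent_momentum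
    (h : R2CHStrip A μ σ Ω c a b u u1 u2 u3 ut vt r r1 rt) (x : ℝ) :
    ∀ t ∈ Icc a b, HasDerivWithinAt
      (fun s => oddTent (fun y => u s y - u2 s y + Ω * (r s y ^ 2 - 1)) x)
      (-(A * u t x - 3 / 2 * u t x ^ 2 - μ * u2 t x - c * (r t x ^ 2 - 1) / 2
          + σ * (u t x * u2 t x + u1 t x ^ 2 / 2))
        + (A * evenTent (u t) x - 3 / 2 * evenTent (fun y => u t y ^ 2) x
          - μ * (u t (x + 1) - 2 * u t x + u t (x - 1))
          - c / 2 * evenTent (fun y => r t y ^ 2 - 1) x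
          + σ / 2 * (u t (x + 1) ^ 2 - 2 * u t x ^ 2 + u t (x - 1) ^ 2)
          - σ / 2 * evenTent (fun y => u1 t y ^ 2) x)) (Icc a b) t := by
  intro t ht
  have := h.cu; have := h.cu1; have := h.cu2; have := h.cu3; have := h.cr; have := h.cr1
  have := h.cut; have := h.cvt; have := h.crt
  have hd : ∀ x, ∀ t ∈ Icc a b, HasDerivWithinAt
      (fun s => u s x - u2 s x + Ω * (r s x ^ 2 - 1))
      (ut t x - vt t x + Ω * (2 * r t x * rt t x)) (Icc a b) t := fun x t ht =>
    (((h.tu x t ht).sub (h.tu2 x t ht)).add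
      ((((h.tr x t ht).fun_pow 2).sub_const 1).const_mul Ω)).congr_deriv (by simp)
  refine (hasDerivWithinAt_oddTent (by fun_prop) (by fun_prop) hd x t ht).congr_deriv ?_
  have hH : ∀ x, HasDerivAt (fun x => A * u t x - 3 / 2 * u t x ^ 2 - μ * u2 t x
      - c * (r t x ^ 2 - 1) / 2 + σ * (u t x * u2 t x + u1 t x ^ 2 / 2))
      (ut t x - vt t x + Ω * (2 * r t x * rt t x)) x := fun x => by
    refine ((((((h.du t x).const_mul A).sub (((h.du t x).fun_pow 2).const_mul (3 / 2))).sub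
      ((h.du2 t x).const_mul μ)).sub
      (((((h.dr t x).fun_pow 2).sub_const 1).const_mul c).div_const 2)).add
      ((((h.du t x).mul (h.du2 t x)).add (((h.du1 t x).fun_pow 2).div_const 2)).const_mul
        σ)).congr_deriv ?_
    rw [h.eq_u, h.eq_r]
    simp
    ring
  have hsq : ∀ x, HasDerivAt (fun x => u t x ^ 2) (2 * u t x * u1 t x) x := fun x =>
    ((h.du t x).fun_pow 2).congr_deriv (by simp)
  have hsq' : ∀ x, HasDerivAt (fun x => 2 * u t x * u1 t x)
      (2 * u1 t x ^ 2 + 2 * (u t x * u2 t x)) x := fun x =>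
    (((h.du t x).const_mul 2).mul (h.du1 t x)).congr_deriv (by ring)
  rw [oddTent_deriv hH (by fun_prop)]
  have e : (fun x => A * u t x - 3 / 2 * u t x ^ 2 - μ * u2 t x
      - c * (r t x ^ 2 - 1) / 2 + σ * (u t x * u2 t x + u1 t x ^ 2 / 2)) =
      fun x => ((A * u t x + (-(3 / 2)) * u t x ^ 2) + ((-μ) * u2 t x + (-(c / 2)) * (r t x ^ 2 - 1)))
        + (σ / 2 * (2 * u1 t x ^ 2 + 2 * (u t x * u2 t x)) + (-(σ / 2)) * u1 t x ^ 2) := by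
    ext; ring
  rw [e, evenTent_add (by fun_prop) (by fun_prop), evenTent_add (by fun_prop) (by fun_prop),
    evenTent_add (by fun_prop) (by fun_prop), evenTent_add (by fun_prop) (by fun_prop),
    evenTent_add (by fun_prop) (by fun_prop), evenTent_const_mul, evenTent_const_mul,
    evenTent_const_mul, evenTent_const_mul, evenTent_const_mul, evenTent_const_mul,
    evenTent_deriv_deriv (h.du t) (h.du1 t) (by fun_prop),
    evenTent_deriv_deriv hsq hsq' (by fun_prop)]
  ring

/-- The weak form of `∂ₜ(u_xx) = (∂ₜu)_xx`. -/
theorem integral_ut_mul_deriv_deriv (h : R2CHStrip A μ σ Ω c a b u u1 u2 u3 ut vt r r1 rt)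
    (hab : a < b) {R : ℝ} (hR : 0 ≤ R) {φ φ' φ'' : ℝ → ℝ} (hφ : ∀ x, HasDerivAt φ (φ' x) x)
    (hφ' : ∀ x, HasDerivAt φ' (φ'' x) x) (hc : Continuous φ'') (h0 : φ R = 0) (h0' : φ (-R) = 0)
    (h1 : φ' R = 0) (h1' : φ' (-R) = 0) {t : ℝ} (ht : t ∈ Icc a b) :
    ∫ x in -R..R, (vt t x * φ x - ut t x * φ'' x) = 0 := by
  have := h.cu; have := h.cu1; have := h.cu2; have := h.cut; have := h.cvt
  have := (continuous_iff_continuousAt.2 fun x => (hφ x).continuousAt : Continuous φ)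
  have hd := hasDerivWithinAt_intervalIntegral (by linarith : -R ≤ R) (a := a) (b := b)
    (F := fun s x => u2 s x * φ x - u s x * φ'' x)
    (F' := fun s x => vt s x * φ x - ut s x * φ'' x) (fun s => by fun_prop) (by fun_prop)
    (fun x t ht => ((h.tu2 x t ht).mul_const _).sub ((h.tu x t ht).mul_const _)) t ht
  have hz : ∀ s, ∫ x in -R..R, (u2 s x * φ x - u s x * φ'' x) = 0 := fun s => by
    have key : ∀ x, HasDerivAt (fun x => u1 s x * φ x - u s x * φ' x)
        (u2 s x * φ x - u s x * φ'' x) x := fun x =>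
      (((h.du1 s x).mul (hφ x)).sub ((h.du s x).mul (hφ' x))).congr_deriv (by ring)
    rw [intervalIntegral.integral_eq_sub_of_hasDerivAt (fun x _ => key x)
      ((by fun_prop : Continuous _).intervalIntegrable _ _)]
    simp [h0, h0', h1, h1']
  simp only [hz] at hd
  exact (uniqueDiffOn_Icc hab t ht).eq_deriv _ hd (hasDerivWithinAt_const _ _ _)

/-- The localized energy and its time derivative. -/
theorem hasDerivWithinAt_integral_energy_mul
    (h : R2CHStrip A μ σ Ω c a b u u1 u2 u3 ut vt r r1 rt)
    (hab : a < b) {R : ℝ} (hR : 0 ≤ R) {χ χ1 χ2 : ℝ → ℝ} (hχ : ∀ x, HasDerivAt χ (χ1 x) x)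
    (hχ1 : ∀ x, HasDerivAt χ1 (χ2 x) x) (hc : Continuous χ2) (h0 : χ R = 0) (h0' : χ (-R) = 0)
    (h1 : χ1 R = 0) (h1' : χ1 (-R) = 0) {t : ℝ} (ht : t ∈ Icc a b) :
    HasDerivWithinAt
      (fun s => ∫ x in -R..R, (u s x ^ 2 + u1 s x ^ 2 + c * (r s x - 1) ^ 2) * χ x)
      (∫ x in -R..R, (-(A * u t x ^ 2 - 2 * u t x ^ 3 + μ * u1 t x ^ 2
          - 2 * c * ((r t x - 1) * (r t x * u t x)) + 2 * Ω * (r t x * u t x) ^ 2) * χ1 x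
        + (4 * σ * u t x - 2 * μ) * u1 t x ^ 2 * χ1 x
        + (2 * σ * u t x ^ 2 - 2 * μ * u t x) * u1 t x * χ2 x
        + 2 * ut t x * (u1 t x * χ1 x + u t x * χ2 x))) (Icc a b) t := by
  have := h.cu; have := h.cu1; have := h.cu2; have := h.cu3; have := h.cr; have := h.cr1
  have := h.cut; have := h.cvt; have := h.crt
  have := (continuous_iff_continuousAt.2 fun x => (hχ x).continuousAt : Continuous χ)
  have := (continuous_iff_continuousAt.2 fun x => (hχ1 x).continuousAt : Continuous χ1)
  have hint : ∀ {f : ℝ → ℝ}, Continuous f → IntervalIntegrable f volume (-R) R :=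
    fun hf => hf.intervalIntegrable _ _
  have hK : ∀ s, ∫ x in -R..R, ((u s x ^ 2 - u s x * u2 s x + c * (r s x - 1) ^ 2) * χ x
      + u s x ^ 2 / 2 * χ2 x) =
      ∫ x in -R..R, (u s x ^ 2 + u1 s x ^ 2 + c * (r s x - 1) ^ 2) * χ x := fun s => by
    have key : ∀ x, HasDerivAt (fun x => u s x ^ 2 / 2 * χ1 x - u s x * u1 s x * χ x)
        (((u s x ^ 2 - u s x * u2 s x + c * (r s x - 1) ^ 2) * χ x + u s x ^ 2 / 2 * χ2 x)
          - (u s x ^ 2 + u1 s x ^ 2 + c * (r s x - 1) ^ 2) * χ x) x := fun x =>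
      (((((h.du s x).fun_pow 2).div_const 2).mul (hχ1 x)).sub
        (((h.du s x).mul (h.du1 s x)).mul (hχ x))).congr_deriv (by simp; ring)
    rw [← sub_eq_zero, ← intervalIntegral.integral_sub (hint (by fun_prop)) (hint (by fun_prop)),
      intervalIntegral.integral_eq_sub_of_hasDerivAt (fun x _ => key x) (hint (by fun_prop))]
    simp [h0, h0', h1, h1']
  have hd := hasDerivWithinAt_intervalIntegral (by linarith : -R ≤ R) (a := a) (b := b)
    (F := fun s x => (u s x ^ 2 - u s x * u2 s x + c * (r s x - 1) ^ 2) * χ x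
      + u s x ^ 2 / 2 * χ2 x)
    (F' := fun s x => (2 * u s x * ut s x - (ut s x * u2 s x + u s x * vt s x)
      + c * (2 * (r s x - 1) * rt s x)) * χ x + u s x * ut s x * χ2 x)
    (fun s => by fun_prop) (by fun_prop)
    (fun x t ht => ((((((h.tu x t ht).fun_pow 2).sub ((h.tu x t ht).mul (h.tu2 x t ht))).add
      ((((h.tr x t ht).sub_const 1).fun_pow 2).const_mul c)).mul_const _).add
      ((((h.tu x t ht).fun_pow 2).div_const 2).mul_const _)).congr_deriv (by
        simp only [Nat.cast_ofNat, Nat.add_one_sub_one, pow_one]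
        ring)) t ht
  simp only [hK] at hd
  refine hd.congr_deriv ?_
  have hw := h.integral_ut_mul_deriv_deriv hab hR (φ := fun x => u t x * χ x)
    (φ' := fun x => u1 t x * χ x + u t x * χ1 x)
    (φ'' := fun x => u2 t x * χ x + 2 * (u1 t x * χ1 x) + u t x * χ2 x)
    (fun x => (h.du t x).mul (hχ x))
    (fun x => (((h.du1 t x).mul (hχ x)).add ((h.du t x).mul (hχ1 x))).congr_deriv (by ring))
    (by fun_prop) (by simp [h0]) (by simp [h0']) (by simp [h0, h1]) (by simp [h0', h1']) ht
  have key : ∀ x, HasDerivAt (fun x => (A * u t x ^ 2 - 2 * u t x ^ 3 + μ * u1 t x ^ 2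
      - 2 * c * ((r t x - 1) * (r t x * u t x)) + 2 * Ω * (r t x * u t x) ^ 2
      + (2 * σ * u t x ^ 2 - 2 * μ * u t x) * u2 t x) * χ x
      - (2 * σ * u t x ^ 2 - 2 * μ * u t x) * (u1 t x * χ1 x))
      (((2 * u t x * ut t x - (ut t x * u2 t x + u t x * vt t x)
        + c * (2 * (r t x - 1) * rt t x)) * χ x + u t x * ut t x * χ2 x)
        + (-1) * (-(A * u t x ^ 2 - 2 * u t x ^ 3 + μ * u1 t x ^ 2
          - 2 * c * ((r t x - 1) * (r t x * u t x)) + 2 * Ω * (r t x * u t x) ^ 2) * χ1 x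
        + (4 * σ * u t x - 2 * μ) * u1 t x ^ 2 * χ1 x
        + (2 * σ * u t x ^ 2 - 2 * μ * u t x) * u1 t x * χ2 x
        + 2 * ut t x * (u1 t x * χ1 x + u t x * χ2 x))
        + (-1) * (vt t x * (u t x * χ x)
          - ut t x * (u2 t x * χ x + 2 * (u1 t x * χ1 x) + u t x * χ2 x))) x := fun x => by
    have d1 := (((((h.du t x).fun_pow 2).const_mul A).sub
      (((h.du t x).fun_pow 3).const_mul 2)).add (((h.du1 t x).fun_pow 2).const_mul μ)).sub
      ((((h.dr t x).sub_const 1).mul ((h.dr t x).mul (h.du t x))).const_mul (2 * c))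
    have d2 := (((h.dr t x).mul (h.du t x)).fun_pow 2).const_mul (2 * Ω)
    have d3 := (((h.du t x).fun_pow 2).const_mul (2 * σ)).sub ((h.du t x).const_mul (2 * μ))
    refine ((((d1.add d2).add (d3.mul (h.du2 t x))).mul (hχ x)).sub
      (d3.mul ((h.du1 t x).mul (hχ1 x)))).congr_deriv ?_
    have e := h.eq_u t x
    rw [h.eq_r]
    simp
    linear_combination (-2 * u t x * χ x) * e
  have hi := intervalIntegral.integral_eq_sub_of_hasDerivAt (a := -R) (b := R)
    (fun x _ => key x) (hint (by fun_prop))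
  rw [intervalIntegral.integral_add (hint (by fun_prop)) (hint (by fun_prop)),
    intervalIntegral.integral_add (hint (by fun_prop)) (hint (by fun_prop)),
    intervalIntegral.integral_const_mul, intervalIntegral.integral_const_mul, hw, h0, h0', h1, h1']
    at hi
  linarith

/-- The conserved quantities of the strip are controlled by `M`, uniformly in time. -/
def BoundedBy (a b M : ℝ) (u u1 r : ℝ → ℝ → ℝ) : Prop :=
  ∀ t ∈ Icc a b, (∀ x, |u t x| ≤ M) ∧ ∫ x, u t x ^ 2 ≤ M ∧ ∫ x, u1 t x ^ 2 ≤ M ∧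
    ∫ x, (r t x - 1) ^ 2 ≤ M

/-- The algebraic estimate behind the Riccati inequality for the averaged momentum. -/
theorem abs_momentum_transport_le {L Y U up um eu eu2 eq e11 : ℝ} (v p R : ℝ) (hM0 : 0 ≤ M)
    (hL : L = |σ| * M + |μ|) (hY : Y = M + |Ω| + 2 * M + |Ω| * (2 + 4 * M) + 4 * M)
    (b0 : |U| ≤ M) (bp : |up| ≤ M) (bm : |um| ≤ M) (e1 : |eu| ≤ 2 * M) (e2 : |eu2| ≤ 2 * M ^ 2)
    (e3 : |eq| ≤ 2 + 4 * M) (e4 : |e11| ≤ 2 * M) :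
    |-(A * U - 3 / 2 * U ^ 2 - μ * v - c * (R ^ 2 - 1) / 2
        + σ * (U * v + p ^ 2 / 2)) + (A * eu - 3 / 2 * eu2 - μ * (up - 2 * U + um)
        - c / 2 * eq + σ / 2 * (up ^ 2 - 2 * U ^ 2 + um ^ 2) - σ / 2 * e11)
        + (σ * U - μ) * (-(U - v + Ω * (R ^ 2 - 1)) + (eu + Ω * eq - (up - 2 * U + um)))| ≤
      |A| * M + 3 / 2 * M ^ 2 + |c| / 2 + L * Y + |A| * (2 * M) + 3 / 2 * (2 * M ^ 2) +
        |μ| * (4 * M) + |c| / 2 * (2 + 4 * M) + |σ| / 2 * (4 * M ^ 2) + |σ| / 2 * (2 * M) +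
        |σ| / 2 * p ^ 2 + (|c| / 2 + L * |Ω|) * R ^ 2 := by
  have s0 := pow_le_pow_left₀ (abs_nonneg _) b0 2
  have sp := pow_le_pow_left₀ (abs_nonneg _) bp 2
  have sm := pow_le_pow_left₀ (abs_nonneg _) bm 2
  rw [sq_abs] at s0 sp sm
  have hV : |σ * U - μ| ≤ L := by
    rw [hL]
    exact (abs_sub _ _).trans (add_le_add (abs_mul_le_mul le_rfl b0) le_rfl)
  have hΩq := abs_mul_le_mul (le_refl |Ω|) e3
  have hYb : |-U + Ω + eu + Ω * eq - (up - 2 * U + um)| ≤ Y := by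
    have := abs_le.1 (le_refl |Ω|)
    rw [abs_le] at *
    constructor <;> linarith
  have hD : |up - 2 * U + um| ≤ 4 * M := by
    rw [abs_le] at *
    constructor <;> linarith
  have hD' : |up ^ 2 - 2 * U ^ 2 + um ^ 2| ≤ 4 * M ^ 2 := by
    rw [abs_le]
    constructor <;> nlinarith [sq_nonneg up, sq_nonneg U, sq_nonneg um]
  have t1 := abs_mul_le_mul (le_refl |A|) b0
  have t2 := abs_mul_le_mul hV hYb
  have t3 := abs_mul_le_mul (le_refl |A|) e1
  have t4 := abs_mul_le_mul (le_refl |μ|) hD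
  have t5 := abs_mul_le_mul (le_refl |c|) e3
  have t6 := abs_mul_le_mul (le_refl |σ|) hD'
  have t7 := abs_mul_le_mul (le_refl |σ|) e4
  have t8 : |c| * R ^ 2 = |c * R ^ 2| := by rw [abs_mul, abs_sq]
  have t9 : |σ| * p ^ 2 = |σ * p ^ 2| := by rw [abs_mul, abs_sq]
  have t10 : |(σ * U - μ) * (Ω * R ^ 2)| ≤ L * (|Ω| * R ^ 2) :=
    abs_mul_le_mul hV (by rw [abs_mul, abs_sq])
  have t11 := abs_le.1 (le_refl |c|)
  have t12 := abs_le.1 t8.ge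
  have t13 := abs_le.1 t9.ge
  have t14 := sq_nonneg U
  rw [abs_le] at t1 t2 t3 t4 t5 t6 t7 t10 e2
  have hsplit : -(A * U - 3 / 2 * U ^ 2 - μ * v - c * (R ^ 2 - 1) / 2
        + σ * (U * v + p ^ 2 / 2)) + (A * eu - 3 / 2 * eu2 - μ * (up - 2 * U + um)
        - c / 2 * eq + σ / 2 * (up ^ 2 - 2 * U ^ 2 + um ^ 2) - σ / 2 * e11)
        + (σ * U - μ) * (-(U - v + Ω * (R ^ 2 - 1)) + (eu + Ω * eq - (up - 2 * U + um))) =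
      -(A * U) + 3 / 2 * U ^ 2 + c * R ^ 2 / 2 - c / 2 - σ * p ^ 2 / 2 + A * eu - 3 / 2 * eu2
        - μ * (up - 2 * U + um) - c * eq / 2 + σ * (up ^ 2 - 2 * U ^ 2 + um ^ 2) / 2
        - σ * e11 / 2 + (σ * U - μ) * (-U + Ω + eu + Ω * eq - (up - 2 * U + um))
        - (σ * U - μ) * (Ω * R ^ 2) := by ring
  rw [hsplit]
  clear hsplit hL hY
  generalize (σ * U - μ) * (-U + Ω + eu + Ω * eq - (up - 2 * U + um)) = z1 at *
  generalize (σ * U - μ) * (Ω * R ^ 2) = z2 at *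
  generalize μ * (up - 2 * U + um) = z3 at *
  generalize σ * (up ^ 2 - 2 * U ^ 2 + um ^ 2) = z4 at *
  rw [abs_le]
  constructor <;> linarith only [t1, t2, t3, t4, t5, t6, t7, t10, t11, t12, t13, t14, e2, s0]

/-- A nonlocal substitute for `u_x` which satisfies a transport equation of Riccati type. -/
theorem exists_averaged_momentum (h : R2CHStrip A μ σ Ω c a b u u1 u2 u3 ut vt r r1 rt)
    (hM0 : 0 ≤ M) (hM : BoundedBy a b M u u1 r) :
    ∃ Q Qt Qx : ℝ → ℝ → ℝ, ∃ C, 0 ≤ C ∧ (Continuous fun p : ℝ × ℝ => Q p.1 p.2) ∧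
      (∀ x, ∀ t ∈ Icc a b, HasDerivWithinAt (fun s => Q s x) (Qt t x) (Icc a b) t) ∧
      (∀ t x, HasDerivAt (Q t) (Qx t x) x) ∧
      (∀ t ∈ Icc a b, ∀ x, |Q t x - u1 t x| ≤ C) ∧
      ∀ t ∈ Icc a b, ∀ x,
        |Qt t x + (σ * u t x - μ) * Qx t x| ≤ C * (1 + u1 t x ^ 2 + r t x ^ 2) := by
  have := h.cu; have := h.cu1; have := h.cu2; have := h.cr
  set L := |σ| * M + |μ| with hL
  set Y := M + |Ω| + 2 * M + |Ω| * (2 + 4 * M) + 4 * M with hY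
  set C₀ := |A| * M + 3 / 2 * M ^ 2 + |c| / 2 + L * Y + |A| * (2 * M) + 3 / 2 * (2 * M ^ 2) +
    |μ| * (4 * M) + |c| / 2 * (2 + 4 * M) + |σ| / 2 * (4 * M ^ 2) + |σ| / 2 * (2 * M) with hC₀
  set C₁ := 2 * M + (2 + 2 * M) + |Ω| * (2 + 4 * M) with hC₁
  have hL0 : 0 ≤ L := by positivity
  have hY0 : 0 ≤ Y := by positivity
  have hC₀0 : 0 ≤ C₀ := by positivity
  have hC₁0 : 0 ≤ C₁ := by positivity
  have hX1 : 0 ≤ |c| / 2 + L * |Ω| := by positivity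
  have zu : ∀ t ∈ Icc a b, ∀ y, |u t y| ≤ M + (fun _ => (0 : ℝ)) y := fun t ht y => by
    simpa using (hM t ht).1 y
  have zu2 : ∀ t ∈ Icc a b, ∀ y, |u t y ^ 2| ≤ M ^ 2 + (fun _ => (0 : ℝ)) y := fun t ht y => by
    simpa using pow_le_pow_left₀ (abs_nonneg _) ((hM t ht).1 y) 2
  have zq : ∀ t y, |r t y ^ 2 - 1| ≤ 1 + 2 * (r t y - 1) ^ 2 := fun t y =>
    abs_le.2 ⟨by nlinarith [sq_nonneg (r t y)], by nlinarith [sq_nonneg (r t y - 2)]⟩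
  have zq' : ∀ t ∈ Icc a b, ∫ y, 2 * (r t y - 1) ^ 2 ≤ 2 * M := fun t ht => by
    rw [integral_const_mul]
    linarith [(hM t ht).2.2.2]
  refine ⟨fun t => oddTent fun y => u t y - u2 t y + Ω * (r t y ^ 2 - 1), _, _,
    max C₁ (C₀ + |σ| / 2 + (|c| / 2 + L * |Ω|)), le_max_of_le_left hC₁0,
    continuous_oddTent (g := fun t y => u t y - u2 t y + Ω * (r t y ^ 2 - 1)) (by fun_prop),
    h.hasDerivWithinAt_oddTent_momentum,
    h.hasDerivAt_oddTent_momentum, fun t ht x => le_max_of_le_left ?_,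
    fun t ht x => (?_ : _ ≤ (C₀ + |σ| / 2 + (|c| / 2 + L * |Ω|)) * _).trans
      (mul_le_mul_of_nonneg_right (le_max_right _ _) (by positivity))⟩
  · have h1 := abs_oddTent_le hM0 (zu t ht) continuous_const (fun _ => le_rfl) (by simp)
      (by simp : _ ≤ (0 : ℝ)) x
    have h2 := abs_evenTent_le zero_le_one
      (fun y => (abs_le.2 ⟨by nlinarith [sq_nonneg (u1 t y + 1)],
        by nlinarith [sq_nonneg (u1 t y - 1)]⟩ : |u1 t y| ≤ 1 + u1 t y ^ 2))
      (by fun_prop) (fun _ => sq_nonneg _) (h.iu1 t) (hM t ht).2.2.1 x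
    have h3 := abs_mul_le_mul le_rfl (abs_oddTent_le zero_le_one (zq t) (by fun_prop)
      (fun _ => by positivity) ((h.ir t).const_mul 2) (zq' t ht) x) (x := Ω)
    beta_reduce
    rw [h.oddTent_momentum, add_sub_cancel_left]
    rw [abs_le] at h1 h2 h3 ⊢
    constructor <;> linarith
  · have e1 := abs_evenTent_le hM0 (zu t ht) continuous_const (fun _ => le_rfl) (by simp)
      (by simp : _ ≤ (0 : ℝ)) x
    have e2 := abs_evenTent_le (sq_nonneg M) (zu2 t ht) continuous_const (fun _ => le_rfl)
      (by simp) (by simp : _ ≤ (0 : ℝ)) x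
    have e3 := abs_evenTent_le zero_le_one (zq t) (by fun_prop)
      (fun _ => by positivity) ((h.ir t).const_mul 2) (zq' t ht) x
    have e4 := abs_evenTent_le (v := fun y => u1 t y ^ 2) le_rfl (fun y => by simp)
      (by fun_prop) (fun _ => sq_nonneg _) (h.iu1 t) (hM t ht).2.2.1 x
    have b0 := (hM t ht).1 x
    have bp := (hM t ht).1 (x + 1)
    have bm := (hM t ht).1 (x - 1)
    generalize evenTent (u t) x = eu at e1 ⊢
    generalize evenTent (fun y => u t y ^ 2) x = eu2 at e2 ⊢
    generalize evenTent (fun y => r t y ^ 2 - 1) x = eq at e3 ⊢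
    generalize evenTent (fun y => u1 t y ^ 2) x = e11 at e4 ⊢
    generalize u t (x + 1) = up at bp ⊢
    generalize u t (x - 1) = um at bm ⊢
    generalize u2 t x = v
    generalize u t x = U at b0 ⊢
    generalize u1 t x = p
    generalize r t x = R
    have n1 : 0 ≤ C₀ * (p ^ 2 + R ^ 2) := by positivity
    have n2 : 0 ≤ |σ| / 2 * (1 + R ^ 2) := by positivity
    have n3 : 0 ≤ (|c| / 2 + L * |Ω|) * (1 + p ^ 2) := by positivity
    refine (abs_momentum_transport_le v p R hM0 hL hY b0 bp bm (by linarith) (by linarith)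
      (by linarith) (by linarith)).trans ?_
    linarith

/-- A bound on the energy propagates boundedness of `u_x` and `ρ` for a short time. -/
theorem exists_locally_bounded (h : R2CHStrip A μ σ Ω c a b u u1 u2 u3 ut vt r r1 rt)
    (hM0 : 0 ≤ M) (hM : BoundedBy a b M u u1 r) {t₀ : ℝ} (ht₀ : t₀ ∈ Icc a b) :
    ∃ δ > 0, ∃ B, ∀ t ∈ Icc a b, |t - t₀| ≤ δ → ∀ x, |u1 t x| ≤ B ∧ |r t x| ≤ B := by
  obtain ⟨Q, Qt, Qx, C, hC, cQ, hQt, hQx, hQu, hQ⟩ := h.exists_averaged_momentum hM0 hM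
  obtain ⟨B₀, hB₀⟩ := h.br t₀
  have hu1 := sq_le_integral_sq_add_sq (h.du1 t₀)
    (by have := h.cu2; fun_prop) (h.lu1 t₀) (h.iu1 t₀) (h.iu2 t₀)
  set N := (∫ x, u1 t₀ x ^ 2) + ∫ x, u2 t₀ x ^ 2
  have hN : 0 ≤ N := (sq_nonneg _).trans (hu1 0)
  have hsq : ∀ {x y D : ℝ}, |x - y| ≤ D → x ^ 2 ≤ 2 * y ^ 2 + 2 * D ^ 2 := fun {x y D} hxy => by
    have := sq_le_sq' (abs_le.1 hxy).1 (abs_le.1 hxy).2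
    nlinarith [sq_nonneg (x - 2 * y)]
  have hcr := h.cr
  have hcu := h.cu
  obtain ⟨δ, hδ, B', hB'⟩ := exists_forall_le_of_abs_transport_le (ι := Bool) (t₀ := t₀) (a := a)
    (b := b) (B := 1 + 2 * N + 2 * C ^ 2 + 2 * B₀ ^ 2 + 2)
    (C := 2 * (C * (4 + 2 * C ^ 2)) + 2 * (1 + C)) (L := |σ| * M + |μ| + M)
    (g := fun i t x => cond i (r t x ^ 2) (Q t x ^ 2))
    (gt := fun i t x => cond i (2 * r t x * rt t x) (2 * Q t x * Qt t x))
    (gx := fun i t x => cond i (2 * r t x * r1 t x) (2 * Q t x * Qx t x))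
    (V := fun i t x => cond i (u t x) (σ * u t x - μ)) ht₀ (by nlinarith [sq_nonneg B₀])
    (by positivity) (by positivity)
    (by rintro (_ | _) <;> simp only [cond_true, cond_false] <;> fun_prop)
    (by
      rintro (_ | _) x t ht <;> simp only [cond_true, cond_false]
      · exact ((hQt x t ht).fun_pow 2).congr_deriv (by simp)
      · exact ((h.tr x t ht).fun_pow 2).congr_deriv (by simp))
    (by
      rintro (_ | _) t x <;> simp only [cond_true, cond_false]
      · exact ((hQx t x).fun_pow 2).congr_deriv (by simp)
      · exact ((h.dr t x).fun_pow 2).congr_deriv (by simp))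
    (by
      rintro (_ | _) t ht x <;> simp only [cond_true, cond_false]
      · exact (abs_sub _ _).trans (by
          linarith [abs_mul_le_mul (le_refl |σ|) ((hM t ht).1 x)])
      · have := (hM t ht).1 x
        nlinarith [abs_nonneg σ, abs_nonneg μ])
    (by
      intro t ht x S hS hj
      have hQS : Q t x ^ 2 ≤ S := hj false
      have hrS : r t x ^ 2 ≤ S := hj true
      have hQ1 : |Q t x| ≤ S := abs_le_of_sq_le_sq (by nlinarith) (by linarith)
      rintro (_ | _) <;> simp only [cond_true, cond_false]
      · have h1 := hsq (abs_sub_comm (Q t x) (u1 t x) ▸ hQu t ht x)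
        have h2 : |Qt t x + (σ * u t x - μ) * Qx t x| ≤ C * (4 + 2 * C ^ 2) * S := by
          refine (hQ t ht x).trans ?_
          rw [mul_assoc]
          refine mul_le_mul_of_nonneg_left ?_ hC
          nlinarith [sq_nonneg C]
        have h3 := abs_mul_le_mul hQ1 h2
        calc |2 * Q t x * Qt t x + (σ * u t x - μ) * (2 * Q t x * Qx t x)|
            = 2 * |Q t x * (Qt t x + (σ * u t x - μ) * Qx t x)| := by
              rw [← abs_two, ← abs_mul, abs_two]; congr 1; ring
          _ ≤ (2 * (C * (4 + 2 * C ^ 2))) * S ^ 2 := by linarith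
          _ ≤ _ := mul_le_mul_of_nonneg_right (by linarith) (sq_nonneg _)
      · have h1 : |u1 t x| ≤ (1 + C) * S := by
          have := abs_le.1 (hQu t ht x)
          have h2 := abs_le.1 hQ1
          rw [abs_le]
          constructor <;> nlinarith
        have h2 := abs_mul_le_mul (by rwa [abs_sq] : |r t x ^ 2| ≤ S) h1
        calc |2 * r t x * rt t x + u t x * (2 * r t x * r1 t x)|
            = 2 * |r t x ^ 2 * u1 t x| := by
              rw [h.eq_r, ← abs_two, ← abs_mul, abs_two, ← abs_neg]; congr 1; ring
          _ ≤ (2 * (1 + C)) * S ^ 2 := by linarith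
          _ ≤ _ := mul_le_mul_of_nonneg_right (by
            have : 0 ≤ 2 * (C * (4 + 2 * C ^ 2)) := by positivity
            linarith) (sq_nonneg _))
    (by
      rintro (_ | _) x <;> simp only [cond_true, cond_false]
      · nlinarith [hsq (hQu t₀ ht₀ x), hu1 x, sq_nonneg B₀]
      · nlinarith [hsq (hB₀ x), sq_nonneg C])
  refine ⟨δ, hδ, 1 + |B'| + C, fun t ht htδ x => ?_⟩
  have hab : ∀ {y : ℝ}, y ^ 2 ≤ B' → |y| ≤ 1 + |B'| := fun {y} hy =>
    abs_le_of_sq_le_sq (by nlinarith [le_abs_self B', abs_nonneg B']) (by positivity)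
  have hq : |Q t x| ≤ 1 + |B'| := hab (hB' t ht htδ x false)
  have hr : |r t x| ≤ 1 + |B'| := hab (hB' t ht htδ x true)
  have hu := abs_le.1 (hQu t ht x)
  rw [abs_le] at hq
  exact ⟨abs_le.2 ⟨by linarith, by linarith⟩, by linarith⟩

/-- If `u_x` and `ρ` are bounded on the strip, then so is `u_t`. -/
theorem exists_abs_ut_le (h : R2CHStrip A μ σ Ω c a b u u1 u2 u3 ut vt r r1 rt) {B : ℝ}
    (hab : a < b) (hM0 : 0 ≤ M) (hM : BoundedBy a b M u u1 r)
    (hB : ∀ t ∈ Icc a b, ∀ x, |u1 t x| ≤ B ∧ |r t x| ≤ B) :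
    ∃ C, 0 ≤ C ∧ ∀ t ∈ Icc a b, ∀ x, |ut t x| ≤ C := by
  have := h.cu; have := h.cu1; have := h.cu2; have := h.cu3; have := h.cr; have := h.cr1
  have := h.cut; have := h.cvt
  have hB0 : 0 ≤ B := (abs_nonneg _).trans (hB a ⟨le_rfl, hab.le⟩ 0).1
  obtain ⟨D₁, hD₁⟩ : ∃ D, D = |A| * M + 3 / 2 * M ^ 2 + |c| * B ^ 2 / 2 + |σ| * B ^ 2 / 2
    + |Ω| * (B ^ 2 * M) := ⟨_, rfl⟩
  obtain ⟨D₂, hD₂⟩ : ∃ D, D = (|σ| * M + |μ|) * B := ⟨_, rfl⟩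
  obtain ⟨D₃, hD₃⟩ : ∃ D, D = |Ω| * (B ^ 2 * B) := ⟨_, rfl⟩
  have hD₁0 : 0 ≤ D₁ := hD₁ ▸ by positivity
  have hD₂0 : 0 ≤ D₂ := hD₂ ▸ by positivity
  have hD₃0 : 0 ≤ D₃ := hD₃ ▸ by positivity
  have hsq : ∀ {y Z : ℝ}, |y| ≤ Z → |y ^ 2| ≤ Z ^ 2 := fun {y Z} hy => by
    rw [abs_pow]
    exact pow_le_pow_left₀ (abs_nonneg _) hy 2
  have hflux : ∀ t ∈ Icc a b, ∀ L, 0 ≤ L → ∀ x, |∫ z in (0:ℝ)..L, greenKernel L z *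
      ((ut t (x + z) - vt t (x + z)) + (ut t (x - z) - vt t (x - z)))| ≤
      8 * (D₁ + D₂ + D₃) := by
    intro t ht L hL x
    have hP : ∀ x, HasDerivAt (fun x => A * u t x - 3 / 2 * u t x ^ 2 - c * r t x ^ 2 / 2
        - σ * u1 t x ^ 2 / 2 + Ω * (r t x ^ 2 * u t x)) (A * u1 t x - 3 * u t x * u1 t x
        - c * r t x * r1 t x - σ * u1 t x * u2 t x
        + Ω * (2 * r t x * r1 t x * u t x + r t x ^ 2 * u1 t x)) x := fun x =>
      ((((((h.du t x).const_mul A).sub (((h.du t x).fun_pow 2).const_mul (3 / 2))).sub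
        ((((h.dr t x).fun_pow 2).const_mul c).div_const 2)).sub
        ((((h.du1 t x).fun_pow 2).const_mul σ).div_const 2)).add
        ((((h.dr t x).fun_pow 2).mul (h.du t x)).const_mul Ω)).congr_deriv (by simp; ring)
    have hY : ∀ x, HasDerivAt (fun x => (σ * u t x - μ) * u1 t x)
        (σ * u1 t x ^ 2 + (σ * u t x - μ) * u2 t x) x := fun x =>
      ((((h.du t x).const_mul σ).sub_const μ).mul (h.du1 t x)).congr_deriv (by ring)
    have hY' : ∀ x, HasDerivAt (fun x => σ * u1 t x ^ 2 + (σ * u t x - μ) * u2 t x)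
        (3 * σ * u1 t x * u2 t x + (σ * u t x - μ) * u3 t x) x := fun x =>
      ((((h.du1 t x).fun_pow 2).const_mul σ).add
        ((((h.du t x).const_mul σ).sub_const μ).mul (h.du2 t x))).congr_deriv (by simp; ring)
    have key := abs_integral_greenKernel_flux_le (D := D₁ + D₂ + D₃)
      (S := fun x => Ω * (r t x ^ 2 * u1 t x)) hP hY hY' (by fun_prop) (by fun_prop) (by fun_prop)
      (fun x => ?_) (fun x => ?_) (fun x => ?_) hL x
    · convert key using 6 <;> rw [h.eq_u] <;> ring
    · have bu := (hM t ht).1 x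
      have t1 := abs_mul_le_mul (le_refl |A|) bu
      have t2 := hsq bu
      have t3 := abs_mul_le_mul (le_refl |c|) (hsq (hB t ht x).2)
      have t4 := abs_mul_le_mul (le_refl |σ|) (hsq (hB t ht x).1)
      have t5 := abs_mul_le_mul (le_refl |Ω|) (abs_mul_le_mul (hsq (hB t ht x).2) bu)
      rw [abs_le] at *
      constructor <;> linarith
    · have t1 := abs_mul_le_mul (le_refl |σ|) ((hM t ht).1 x)
      have t2 := abs_mul_le_mul ((abs_sub (σ * u t x) μ).trans (add_le_add t1 le_rfl))
        (hB t ht x).1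
      linarith
    · have := abs_mul_le_mul (le_refl |Ω|) (abs_mul_le_mul (hsq (hB t ht x).2) (hB t ht x).1)
      linarith
  refine ⟨8 * (D₁ + D₂ + D₃), by positivity, fun t ht x =>
    abs_le_of_hasDerivWithinAt_of_lipschitz hab ht (h.tu x t ht) fun s hs => ?_⟩
  refine le_of_forall_pos_le_add fun ε hε => ?_
  set L := 4 * M / ε with hL
  have hL0 : 0 ≤ L := by positivity
  have hder := hasDerivWithinAt_intervalIntegral hL0 (a := a) (b := b)
    (F := fun t z => greenKernel L z *
      ((u t (x + z) - u2 t (x + z)) + (u t (x - z) - u2 t (x - z))))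
    (F' := fun t z => greenKernel L z *
      ((ut t (x + z) - vt t (x + z)) + (ut t (x - z) - vt t (x - z))))
    (fun t => by fun_prop) (by fun_prop) (fun z t ht =>
      (((h.tu _ t ht).sub (h.tu2 _ t ht)).add ((h.tu _ t ht).sub (h.tu2 _ t ht))).const_mul _)
  have hlip := Convex.norm_image_sub_le_of_norm_hasDerivWithin_le hder
    (fun τ hτ => hflux τ hτ L hL0 x) (convex_Icc a b) ht hs
  rw [integral_greenKernel_momentum (h.du s) (h.du1 s) (by fun_prop),
    integral_greenKernel_momentum (h.du t) (h.du1 t) (by fun_prop), norm_eq_abs, norm_eq_abs]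
    at hlip
  have hcosh : L / 2 ≤ cosh L := by
    rw [cosh_eq]
    linarith [add_one_le_exp L, exp_pos (-L)]
  have hcp := cosh_pos L
  have htail : ∀ τ ∈ Icc a b, |(u τ (x + L) + u τ (x - L)) / (2 * cosh L)| ≤ ε / 2 := by
    intro τ hτ
    rw [abs_div, div_le_iff₀ (abs_pos.2 (by linarith)), abs_of_pos (by linarith : 0 < 2 * cosh L)]
    have h1 := (abs_add_le _ _).trans (add_le_add ((hM τ hτ).1 (x + L)) ((hM τ hτ).1 (x - L)))
    have h2 : L * ε = 4 * M := by rw [hL]; field_simp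
    nlinarith
  have h1 := htail t ht
  have h2 := htail s hs
  rw [abs_le] at hlip h1 h2 ⊢
  constructor <;> linarith

/-- Pointwise bound for the flux density of the localized energy. -/
theorem abs_energy_flux_le {B C ε s U p R v x1 x2 : ℝ} (hU : |U| ≤ M)
    (hR : |R| ≤ B) (hv : |v| ≤ C) (hx1 : |x1| ≤ ε) (hx2 : |x2| ≤ ε)
    (hs : U ^ 2 + p ^ 2 + (R - 1) ^ 2 ≤ s) (hs' : |p| + |U| ≤ s) :
    |-(A * U ^ 2 - 2 * U ^ 3 + μ * p ^ 2 - 2 * c * ((R - 1) * (R * U)) + 2 * Ω * (R * U) ^ 2) * x1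
        + (4 * σ * U - 2 * μ) * p ^ 2 * x1 + (2 * σ * U ^ 2 - 2 * μ * U) * p * x2
        + 2 * v * (p * x1 + U * x2)| ≤
      (|A| + 2 * M + 5 * |μ| + 2 * |c| * B + 2 * |Ω| * B ^ 2 + 6 * |σ| * M + 2 * C) * s * ε := by
  have hM0 : 0 ≤ M := (abs_nonneg _).trans hU
  have hB0 : 0 ≤ B := (abs_nonneg _).trans hR
  have hC0 : 0 ≤ C := (abs_nonneg _).trans hv
  have hε0 : 0 ≤ ε := (abs_nonneg _).trans hx1
  have s1 : |U ^ 2| ≤ s := by rw [abs_sq]; nlinarith [sq_nonneg p, sq_nonneg (R - 1)]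
  have s2 : |p ^ 2| ≤ s := by rw [abs_sq]; nlinarith [sq_nonneg U, sq_nonneg (R - 1)]
  have s3 : |(R - 1) * U| ≤ s := abs_le.2
    ⟨by nlinarith [sq_nonneg (R - 1 + U), sq_nonneg p],
      by nlinarith [sq_nonneg (R - 1 - U), sq_nonneg p]⟩
  have s4 : |U * p| ≤ s := abs_le.2
    ⟨by nlinarith [sq_nonneg (p + U), sq_nonneg (R - 1)],
      by nlinarith [sq_nonneg (p - U), sq_nonneg (R - 1)]⟩
  have hR2 : |R ^ 2| ≤ B ^ 2 := by
    rw [abs_pow]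
    exact pow_le_pow_left₀ (abs_nonneg _) hR 2
  have hL : |σ * U - μ| ≤ |σ| * M + |μ| :=
    (abs_sub _ _).trans (add_le_add (abs_mul_le_mul le_rfl hU) le_rfl)
  have hL' : |2 * (σ * U) - μ| ≤ 2 * (|σ| * M) + |μ| :=
    (abs_sub _ _).trans (add_le_add (abs_mul_le_mul (by simp)
      (abs_mul_le_mul le_rfl hU)) le_rfl)
  have t1 := abs_mul_le_mul (abs_mul_le_mul (le_refl |A|) s1) hx1
  have t2 := abs_mul_le_mul (abs_mul_le_mul hU s1) hx1
  have t3 := abs_mul_le_mul (abs_mul_le_mul (le_refl |μ|) s2) hx1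
  have t4 := abs_mul_le_mul (abs_mul_le_mul (abs_mul_le_mul (le_refl |c|) hR) s3) hx1
  have t5 := abs_mul_le_mul (abs_mul_le_mul (abs_mul_le_mul (le_refl |Ω|) hR2) s1) hx1
  have t6 := abs_mul_le_mul (abs_mul_le_mul hL' s2) hx1
  have t7 := abs_mul_le_mul (abs_mul_le_mul hL s4) hx2
  have t8 : |v * (p * x1 + U * x2)| ≤ C * (s * ε) := by
    refine abs_mul_le_mul hv (((abs_add_le _ _).trans
      (add_le_add (abs_mul_le_mul le_rfl hx1) (abs_mul_le_mul le_rfl hx2))).trans ?_)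
    rw [← add_mul]
    exact mul_le_mul_of_nonneg_right hs' hε0
  have hsplit : -(A * U ^ 2 - 2 * U ^ 3 + μ * p ^ 2 - 2 * c * ((R - 1) * (R * U))
        + 2 * Ω * (R * U) ^ 2) * x1
        + (4 * σ * U - 2 * μ) * p ^ 2 * x1 + (2 * σ * U ^ 2 - 2 * μ * U) * p * x2
        + 2 * v * (p * x1 + U * x2) =
      -(A * U ^ 2 * x1) + 2 * (U * U ^ 2 * x1) - μ * p ^ 2 * x1
        + 2 * (c * R * ((R - 1) * U) * x1) - 2 * (Ω * R ^ 2 * U ^ 2 * x1)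
        + 2 * ((2 * (σ * U) - μ) * p ^ 2 * x1) + 2 * ((σ * U - μ) * (U * p) * x2)
        + 2 * (v * (p * x1 + U * x2)) := by ring
  rw [hsplit]
  rw [abs_le] at *
  constructor <;> linarith

theorem integrable_energy (h : R2CHStrip A μ σ Ω c a b u u1 u2 u3 ut vt r r1 rt) (t : ℝ) :
    Integrable fun x => u t x ^ 2 + u1 t x ^ 2 + c * (r t x - 1) ^ 2 :=
  ((h.iu t).add (h.iu1 t)).add ((h.ir t).const_mul c)

/-- Energy conservation on a strip on which `u_x` and `ρ` are bounded. -/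
theorem energy_eq_of_bounded (h : R2CHStrip A μ σ Ω c a b u u1 u2 u3 ut vt r r1 rt) {B : ℝ}
    (hab : a < b) (hM0 : 0 ≤ M) (hM : BoundedBy a b M u u1 r)
    (hB : ∀ t ∈ Icc a b, ∀ x, |u1 t x| ≤ B ∧ |r t x| ≤ B) :
    ∫ x, (u b x ^ 2 + u1 b x ^ 2 + c * (r b x - 1) ^ 2) =
      ∫ x, (u a x ^ 2 + u1 a x ^ 2 + c * (r a x - 1) ^ 2) := by
  have := h.cu; have := h.cu1; have := h.cr; have := h.cut
  obtain ⟨C, hC0, hC⟩ := h.exists_abs_ut_le hab hM0 hM hB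
  have hB0 : 0 ≤ B := (abs_nonneg _).trans (hB a ⟨le_rfl, hab.le⟩ 0).1
  obtain ⟨D, hD⟩ : ∃ D, D = |A| + 2 * M + 5 * |μ| + 2 * |c| * B + 2 * |Ω| * B ^ 2
    + 6 * |σ| * M + 2 * C := ⟨_, rfl⟩
  have hD0 : 0 ≤ D := hD ▸ by positivity
  have hflux : ∀ η : ℝ, 0 < η → η ≤ 1 → ∀ t ∈ Icc a b, ∀ χ1 χ2 : ℝ → ℝ,
      (∀ x ∈ Icc (-(1 / η ^ 2)) (1 / η ^ 2), |χ1 x| ≤ 30 / (1 / η ^ 2) ∧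
        |χ2 x| ≤ 30 / (1 / η ^ 2)) →
      |∫ x in -(1 / η ^ 2)..1 / η ^ 2, (-(A * u t x ^ 2 - 2 * u t x ^ 3 + μ * u1 t x ^ 2
          - 2 * c * ((r t x - 1) * (r t x * u t x)) + 2 * Ω * (r t x * u t x) ^ 2) * χ1 x
        + (4 * σ * u t x - 2 * μ) * u1 t x ^ 2 * χ1 x
        + (2 * σ * u t x ^ 2 - 2 * μ * u t x) * u1 t x * χ2 x
        + 2 * ut t x * (u1 t x * χ1 x + u t x * χ2 x))| ≤ D * 30 * (2 + 3 * M) * η := by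
    intro η hη hη1 t ht χ1 χ2 hχ
    have hη2 : 0 < 1 / η ^ 2 := by positivity
    have hi2 : Integrable fun x => u t x ^ 2 + u1 t x ^ 2 := (h.iu t).add (h.iu1 t)
    have hi3 : Integrable fun x => u t x ^ 2 + u1 t x ^ 2 + (r t x - 1) ^ 2 := hi2.add (h.ir t)
    have hi3c : Continuous fun x => u t x ^ 2 + u1 t x ^ 2 + (r t x - 1) ^ 2 := by fun_prop
    have hle : ∫ x in -(1 / η ^ 2)..1 / η ^ 2, (u t x ^ 2 + u1 t x ^ 2 + (r t x - 1) ^ 2) ≤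
        3 * M := by
      rw [intervalIntegral.integral_of_le (by linarith)]
      refine (setIntegral_le_integral hi3 (Eventually.of_forall fun x => by positivity)).trans ?_
      rw [integral_add hi2 (h.ir t), integral_add (h.iu t) (h.iu1 t)]
      linarith [(hM t ht).2.1, (hM t ht).2.2.1, (hM t ht).2.2.2]
    have hb := intervalIntegral.norm_integral_le_of_norm_le (a := -(1 / η ^ 2)) (b := 1 / η ^ 2)
      (μ := volume) (g := fun x => D * (30 / (1 / η ^ 2)) *
        (η + (1 / η) * (u t x ^ 2 + u1 t x ^ 2 + (r t x - 1) ^ 2)))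
      (f := fun x => (-(A * u t x ^ 2 - 2 * u t x ^ 3 + μ * u1 t x ^ 2
          - 2 * c * ((r t x - 1) * (r t x * u t x)) + 2 * Ω * (r t x * u t x) ^ 2) * χ1 x
        + (4 * σ * u t x - 2 * μ) * u1 t x ^ 2 * χ1 x
        + (2 * σ * u t x ^ 2 - 2 * μ * u t x) * u1 t x * χ2 x
        + 2 * ut t x * (u1 t x * χ1 x + u t x * χ2 x))) (by linarith)
      (Eventually.of_forall fun x hx => ?_) ((by fun_prop : Continuous _).intervalIntegrable _ _)
    · rw [norm_eq_abs] at hb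
      refine hb.trans ?_
      rw [intervalIntegral.integral_const_mul, intervalIntegral.integral_add
        ((by fun_prop : Continuous _).intervalIntegrable _ _)
        ((by fun_prop : Continuous _).intervalIntegrable _ _), intervalIntegral.integral_const_mul,
        intervalIntegral.integral_const, smul_eq_mul]
      calc _ ≤ D * (30 / (1 / η ^ 2)) * ((1 / η ^ 2 - -(1 / η ^ 2)) * η + 1 / η * (3 * M)) := by
            gcongr
        _ = _ := by field_simp; ring
    · have hx' := hχ x (Ioc_subset_Icc_self hx)
      rw [norm_eq_abs]
      have he0 : 0 ≤ u t x ^ 2 + u1 t x ^ 2 + (r t x - 1) ^ 2 := by positivity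
      have hη' : 1 ≤ 1 / η := by rw [le_div_iff₀ hη]; linarith
      have hyoung : ∀ y : ℝ, |y| ≤ η / 2 + 1 / η * y ^ 2 / 2 := fun y => by
        have h1 : η / 2 + 1 / η * y ^ 2 / 2 - |y| = (|y| - η) ^ 2 / (2 * η) := by
          rw [← sq_abs y]
          field_simp
          ring
        have h2 : 0 ≤ (|y| - η) ^ 2 / (2 * η) := by positivity
        linarith
      have := abs_energy_flux_le (A := A) (μ := μ) (σ := σ) (Ω := Ω) (c := c)
        (s := η + (1 / η) * (u t x ^ 2 + u1 t x ^ 2 + (r t x - 1) ^ 2)) ((hM t ht).1 x)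
        (hB t ht x).2 (hC t ht x) hx'.1 hx'.2 (p := u1 t x) (by nlinarith) (by
          have h1 := hyoung (u t x)
          have h2 := hyoung (u1 t x)
          have h3 : 0 ≤ 1 / η * (u t x ^ 2 + u1 t x ^ 2 + 2 * (r t x - 1) ^ 2) := by positivity
          linarith)
      rw [← hD] at this
      exact this.trans_eq (by ring)
  have hKη : ∀ η : ℝ, 0 < η → η ≤ 1 → ∀ R : ℝ, 1 / η ^ 2 = R →
      |(∫ x in -R..R, (u b x ^ 2 + u1 b x ^ 2 + c * (r b x - 1) ^ 2) * (1 - (x / R) ^ 2) ^ 3)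
        - ∫ x in -R..R, (u a x ^ 2 + u1 a x ^ 2 + c * (r a x - 1) ^ 2) * (1 - (x / R) ^ 2) ^ 3| ≤
      D * 30 * (2 + 3 * M) * η * (b - a) := by
    intro η hη hη1 R hηR
    have hR : 1 ≤ R := by
      rw [← hηR, le_div_iff₀ (by positivity), one_mul]
      exact pow_le_one₀ hη.le hη1
    have hR0 : R ≠ 0 := by positivity
    have := Convex.norm_image_sub_le_of_norm_hasDerivWithin_le (s := Icc a b) (x := a) (y := b)
      (fun t ht => h.hasDerivWithinAt_integral_energy_mul hab (R := R) (by linarith)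
        (hasDerivAt_cutoff R) (hasDerivAt_cutoff_deriv R) (by fun_prop) (by simp [hR0])
        (by simp [hR0]) (by simp [hR0]) (by simp [hR0]) ht)
      (fun t ht => by
        have := hflux η hη hη1 t ht
          (fun x => -6 * (x / R) / R * (1 - (x / R) ^ 2) ^ 2)
          (fun x => (-6 * (1 - (x / R) ^ 2) ^ 2 + 24 * (x / R) ^ 2 * (1 - (x / R) ^ 2)) / R ^ 2)
        rw [hηR] at this
        exact this fun x hx => ⟨abs_cutoff_deriv_le hR hx, abs_cutoff_deriv_deriv_le hR hx⟩)
      (convex_Icc a b) ⟨le_rfl, hab.le⟩ ⟨hab.le, le_rfl⟩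
    rwa [norm_eq_abs, norm_eq_abs, abs_of_pos (sub_pos.2 hab)] at this
  have hK := fun n : ℕ => hKη (1 / ((n : ℝ) + 1)) (by positivity)
    (by rw [div_le_one (by positivity)]; simp) (((n : ℝ) + 1) ^ 2) (by simp)
  have hlim := (((tendsto_integral_mul_cutoff (h.integrable_energy b)).sub
    (tendsto_integral_mul_cutoff (h.integrable_energy a))).abs)
  have hlim' : Tendsto (fun n : ℕ => D * 30 * (2 + 3 * M) * (1 / ((n : ℝ) + 1)) * (b - a)) atTop
      (𝓝 (D * 30 * (2 + 3 * M) * 0 * (b - a))) :=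
    (tendsto_one_div_add_atTop_nhds_zero_nat.const_mul _).mul_const _
  have := le_of_tendsto_of_tendsto' hlim hlim' hK
  rw [mul_zero, zero_mul] at this
  exact sub_eq_zero.1 (abs_nonpos_iff.1 this)

/-- Energy conservation on a strip on which the energy is bounded. -/
theorem energy_eq_of_boundedBy (h : R2CHStrip A μ σ Ω c a b u u1 u2 u3 ut vt r r1 rt)
    (hab : a ≤ b) (hM0 : 0 ≤ M) (hM : BoundedBy a b M u u1 r) :
    ∫ x, (u b x ^ 2 + u1 b x ^ 2 + c * (r b x - 1) ^ 2) =
      ∫ x, (u a x ^ 2 + u1 a x ^ 2 + c * (r a x - 1) ^ 2) := by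
  refine constant_on_Icc_of_locally_constant
    (f := fun t => ∫ x, (u t x ^ 2 + u1 t x ^ 2 + c * (r t x - 1) ^ 2)) hab fun t₀ ht₀ => ?_
  obtain ⟨δ, hδ, B, hB⟩ := h.exists_locally_bounded hM0 hM ht₀
  have key : ∀ s ∈ Icc a b, ∀ t ∈ Icc a b, s < t → |s - t₀| ≤ δ → |t - t₀| ≤ δ →
      ∫ x, (u t x ^ 2 + u1 t x ^ 2 + c * (r t x - 1) ^ 2) =
        ∫ x, (u s x ^ 2 + u1 s x ^ 2 + c * (r s x - 1) ^ 2) := by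
    intro s hs t ht hst hsδ htδ
    have hsub : Icc s t ⊆ Icc a b := Icc_subset_Icc hs.1 ht.2
    refine (h.mono hs.1 ht.2).energy_eq_of_bounded hst hM0 (fun q hq => hM q (hsub hq))
      fun q hq => hB q (hsub hq) ?_
    rw [abs_le] at *
    exact ⟨by linarith [hq.1], by linarith [hq.2]⟩
  refine ⟨δ, hδ, fun s hs hsδ => ?_⟩
  rcases lt_trichotomy s t₀ with hlt | rfl | hlt
  · exact (key s hs t₀ ht₀ hlt hsδ.le (by simpa using hδ.le)).symm
  · rfl
  · exact key t₀ ht₀ s hs hlt (by simpa using hδ.le) hsδ.le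

/-- For `c > 0`, a bound on the energy controls `u`, `u_x` and `ρ - 1`. -/
theorem boundedBy_of_energy_le (h : R2CHStrip A μ σ Ω c a b u u1 u2 u3 ut vt r r1 rt)
    (hc : 0 < c) (hM : ∀ t ∈ Icc a b,
      ∫ x, (u t x ^ 2 + u1 t x ^ 2 + c * (r t x - 1) ^ 2) ≤ M) :
    BoundedBy a b (|M| + 1 + |M| / c) u u1 r := by
  intro t ht
  have hsum : (∫ x, u t x ^ 2) + (∫ x, u1 t x ^ 2) + c * ∫ x, (r t x - 1) ^ 2 ≤ |M| := by
    refine le_trans (le_of_eq ?_) ((hM t ht).trans (le_abs_self M))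
    have h2 : Integrable fun x => u t x ^ 2 + u1 t x ^ 2 := (h.iu t).add (h.iu1 t)
    rw [integral_add h2 ((h.ir t).const_mul c), integral_add (h.iu t) (h.iu1 t),
      integral_const_mul]
  have p0 : 0 ≤ ∫ x, u t x ^ 2 := integral_nonneg fun x => sq_nonneg _
  have p1 : 0 ≤ ∫ x, u1 t x ^ 2 := integral_nonneg fun x => sq_nonneg _
  have p2 : 0 ≤ ∫ x, (r t x - 1) ^ 2 := integral_nonneg fun x => sq_nonneg _
  have p3 := mul_nonneg hc.le p2
  have p4 : 0 ≤ |M| / c := by positivity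
  refine ⟨fun x => ?_, by linarith, by linarith, ?_⟩
  · have hcu1 := h.cu1
    have := sq_le_integral_sq_add_sq (h.du t) (by fun_prop) (h.lu t) (h.iu t) (h.iu1 t) x
    have : |u t x| ^ 2 ≤ |M| := by rw [sq_abs]; linarith
    nlinarith [sq_nonneg (|u t x| - 1)]
  · have : ∫ x, (r t x - 1) ^ 2 ≤ |M| / c := by
      rw [le_div_iff₀ hc]
      linarith
    linarith [abs_nonneg M]

/-- The energy is a lower semicontinuous function of time. -/
theorem isClosed_energy_le (h : R2CHStrip A μ σ Ω c a b u u1 u2 u3 ut vt r r1 rt) (hc : 0 < c)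
    (k : ℝ) : IsClosed {t | t ∈ Icc a b ∧
      ∫ x, (u t x ^ 2 + u1 t x ^ 2 + c * (r t x - 1) ^ 2) ≤ k} := by
  have := h.cu; have := h.cu1; have := h.cr
  have e : {t | t ∈ Icc a b ∧ ∫ x, (u t x ^ 2 + u1 t x ^ 2 + c * (r t x - 1) ^ 2) ≤ k} =
      Icc a b ∩ ⋂ n : ℕ, {t | ∫ x in -(n : ℝ)..n,
        (u t x ^ 2 + u1 t x ^ 2 + c * (r t x - 1) ^ 2) ≤ k} := by
    ext t
    simp only [mem_ofPred_eq, mem_inter_iff, mem_iInter]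
    refine and_congr_right fun _ => ⟨fun ht n => ?_, fun ht => ?_⟩
    · rw [intervalIntegral.integral_of_le (by simp)]
      exact (setIntegral_le_integral (h.integrable_energy t)
        (Eventually.of_forall fun x => by positivity)).trans ht
    · exact le_of_tendsto' (intervalIntegral_tendsto_integral (h.integrable_energy t)
        (tendsto_neg_atTop_atBot.comp tendsto_natCast_atTop_atTop)
        tendsto_natCast_atTop_atTop) ht
  rw [e]
  refine isClosed_Icc.inter (isClosed_iInter fun n => isClosed_le ?_ continuous_const)
  exact intervalIntegral.continuous_parametric_intervalIntegral_of_continuous' (by fun_prop) _ _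

/-- Energy conservation on a strip. -/
theorem energy_eq (h : R2CHStrip A μ σ Ω c a b u u1 u2 u3 ut vt r r1 rt) (hc : 0 < c)
    (hab : a ≤ b) :
    ∫ x, (u b x ^ 2 + u1 b x ^ 2 + c * (r b x - 1) ^ 2) =
      ∫ x, (u a x ^ 2 + u1 a x ^ 2 + c * (r a x - 1) ^ 2) :=
  eq_of_isClosed_sublevel_of_eq_of_bounded
    (f := fun t => ∫ x, (u t x ^ 2 + u1 t x ^ 2 + c * (r t x - 1) ^ 2)) hab
    (h.isClosed_energy_le hc) fun _ hs _ ht hst ⟨M, hM⟩ =>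
      have h' := h.mono hs.1 ht.2
      (h'.energy_eq_of_boundedBy hst (by positivity) (h'.boundedBy_of_energy_le hc hM)).symm

end R2CHStrip

/-- A classical solution, with time clamped to `[0, t₁]`, solves the R2CH system on the strip
`[0, t₁] × ℝ`. -/
theorem R2CHSolution.strip {A μ σ Ω T t₁ : ℝ} {u ρ : ℝ → ℝ → ℝ}
    (hsol : R2CHSolution A μ σ Ω T u ρ) {q : ℝ → ℝ} (hq : Continuous q)
    (hqI : ∀ t, q t ∈ Ico 0 T) (hq_eq : EqOn q id (Icc 0 t₁)) :
    R2CHStrip A μ σ Ω (1 - 2 * Ω * A) 0 t₁ (fun t => u (q t)) (fun t => deriv (u (q t)))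
      (fun t => deriv (deriv (u (q t)))) (fun t => deriv (deriv (deriv (u (q t)))))
      (fun t x => derivWithin (fun s => u s x) (Ico 0 T) (q t))
      (fun t x => derivWithin (fun s => deriv (deriv (u s)) x) (Ico 0 T) (q t))
      (fun t => ρ (q t)) (fun t => deriv (ρ (q t)))
      (fun t x => derivWithin (fun s => ρ s x) (Ico 0 T) (q t)) := by
  have hcomp : ∀ {F : ℝ × ℝ → ℝ}, ContinuousOn F (Ico 0 T ×ˢ (univ : Set ℝ)) →
      Continuous fun p : ℝ × ℝ => F (q p.1, p.2) := fun hF =>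
    hF.comp_continuous (by fun_prop) fun p => ⟨hqI p.1, mem_univ _⟩
  have hsub : Icc 0 t₁ ⊆ Ico 0 T := fun t ht => by simpa [hq_eq ht] using hqI t
  have htime : ∀ {f : ℝ → ℝ}, (∀ t ∈ Ico 0 T, DifferentiableWithinAt ℝ f (Ico 0 T) t) →
      ∀ t ∈ Icc 0 t₁, HasDerivWithinAt (fun s => f (q s)) (derivWithin f (Ico 0 T) (q t))
        (Icc 0 t₁) t := fun {f} hf t ht => by
    rw [show q t = t from hq_eq ht]
    exact ((hf t (hsub ht)).hasDerivWithinAt.mono hsub).congr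
      (fun s hs => congrArg f (hq_eq hs)) (congrArg f (hq_eq ht))
  have hu : ∀ t, ContDiff ℝ 3 (u (q t)) := fun t => hsol.u_smooth _ (hqI t)
  have hu1 : ∀ t, ContDiff ℝ 2 (deriv (u (q t))) := fun t =>
    (contDiff_succ_iff_deriv (n := 2).1 (hu t)).2.2
  have hu2 : ∀ t, ContDiff ℝ 1 (deriv (deriv (u (q t)))) := fun t =>
    (contDiff_succ_iff_deriv (n := 1).1 (hu1 t)).2.2
  have hdu : ∀ t x, HasDerivAt (u (q t)) (deriv (u (q t)) x) x := fun t x =>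
    ((hu t).differentiable (by norm_num) x).hasDerivAt
  have hdr : ∀ t x, HasDerivAt (ρ (q t)) (deriv (ρ (q t)) x) x := fun t x =>
    ((hsol.ρ_smooth _ (hqI t)).differentiable (by norm_num) x).hasDerivAt
  have hbot : (atBot : Filter ℝ) ≤ cocompact ℝ := by
    rw [cocompact_eq_atBot_atTop]
    exact le_sup_left
  exact {
    du := hdu
    du1 := fun t x => ((hu1 t).differentiable (by norm_num) x).hasDerivAt
    du2 := fun t x => ((hu2 t).differentiable (by norm_num) x).hasDerivAt
    dr := hdr
    cu := by simpa using hcomp (hsol.u_jcont 0 (by norm_num))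
    cu1 := by simpa using hcomp (hsol.u_jcont 1 (by norm_num))
    cu2 := by simpa [iteratedDeriv_succ] using hcomp (hsol.u_jcont 2 (by norm_num))
    cu3 := by simpa [iteratedDeriv_succ] using hcomp (hsol.u_jcont 3 (by norm_num))
    cut := hcomp hsol.ut_jcont
    cvt := hcomp hsol.utxx_jcont
    cr := by simpa using hcomp (hsol.ρ_jcont 0 (by norm_num))
    cr1 := by simpa using hcomp (hsol.ρ_jcont 1 (by norm_num))
    crt := hcomp hsol.ρt_jcont
    tu := fun x => htime (hsol.u_tdiff x)
    tu2 := fun x => htime (hsol.uxx_tdiff x)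
    tr := fun x => htime (hsol.ρ_tdiff x)
    eq_u := fun t x => by
      have h := hsol.eq_u _ (hqI t) x
      rw [((hdr t x).fun_mul (hdu t x)).deriv] at h
      linear_combination h
    eq_r := fun t x => by
      have h := hsol.eq_ρ _ (hqI t) x
      rw [((hdu t x).fun_mul (hdr t x)).deriv] at h
      linear_combination h
    iu := fun t => hsol.u_L2 _ (hqI t)
    iu1 := fun t => hsol.ux_L2 _ (hqI t)
    iu2 := fun t => hsol.uxx_L2 _ (hqI t)
    ir := fun t => hsol.ρm1_L2 _ (hqI t)
    lu := fun t => (hsol.u_decay _ (hqI t)).mono_left hbot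
    lu1 := fun t => (hsol.ux_decay _ (hqI t)).mono_left hbot
    br := fun t => hsol.ρm1_Linf _ (hqI t) }

/-- Lemma 2.2: conservation of the energy
`E(t) = ∫ (u² + uₓ² + (1-2ΩA)(ρ-1)²) dx` for classical solutions of R2CH. -/
theorem lemma_2_2 {A μ σ Ω T : ℝ} {u ρ : ℝ → ℝ → ℝ}
    (hΩ : 0 ≤ Ω) (hΩA : 0 < 1 - 2 * Ω * A)
    (hsol : R2CHSolution A μ σ Ω T u ρ) :
    ∀ t ∈ Ico (0:ℝ) T, energy Ω A u ρ t = energy Ω A u ρ 0 := by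
  intro t ht
  have hq : EqOn (fun s => (projIcc 0 t ht.1 s : ℝ)) id (Icc 0 t) := fun s hs => by
    simp [projIcc_of_mem ht.1 hs]
  have h := (hsol.strip (t₁ := t) (q := fun s => projIcc 0 t ht.1 s) (by fun_prop)
    (fun s => ⟨(projIcc 0 t ht.1 s).2.1, (projIcc 0 t ht.1 s).2.2.trans_lt ht.2⟩) hq).energy_eq
    hΩA ht.1
  simpa [energy] using h
end

section
/- Let T > 0 and let w : [0,T) × ℝ → ℝ be continuous with ∂_t w continuous on [0,T) × ℝ. Assume that the map t ↦ w(t,·) is locally Lipschitz from [0,T) into the space of bounded continuous functions on ℝ with the supremum norm, and that for each t ∈ [0,T) the infimum m(t) := inf_{x∈ℝ} w(t,x) is attained at some point of ℝ. Then m is locally Lipschitz on [0,T), hence differentiable almost everywhere on (0,T), and for almost every t ∈ (0,T) one has m'(t) = ∂_t w(t, ξ) for every point ξ ∈ ℝ at which w(t,·) attains its infimum. (Lemma 2.6, the Constantin–Escher lemma, applied with w = ∂_x v) -/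
open Set Filter MeasureTheory Topology Real

lemma iInf_eq_of_forall_le {ι : Type*} {f : ι → ℝ} {i : ι} (h : ∀ j, f i ≤ f j) :
    ⨅ j, f j = f i :=
  IsLeast.csInf_eq ⟨mem_range_self i, forall_mem_range.2 h⟩

/-- The infimum of a family of functions that is uniformly Lipschitz on `J`, with the infimum
attained at each point of `J`, is Lipschitz on `J`. -/
lemma abs_iInf_sub_iInf_le {ι : Type*} {J : Set ℝ} {w : ℝ → ι → ℝ} {L : ℝ}
    (hlip : ∀ s ∈ J, ∀ t ∈ J, ∀ x, |w t x - w s x| ≤ L * |t - s|)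
    (hmin : ∀ t ∈ J, ∃ ξ, ∀ x, w t ξ ≤ w t x) {s t : ℝ} (hs : s ∈ J) (ht : t ∈ J) :
    |(⨅ x, w t x) - ⨅ x, w s x| ≤ L * |t - s| := by
  obtain ⟨ξ, hξ⟩ := hmin t ht
  obtain ⟨η, hη⟩ := hmin s hs
  rw [iInf_eq_of_forall_le hξ, iInf_eq_of_forall_le hη, abs_le]
  have h₁ := abs_le.1 (hlip s hs t ht ξ)
  have h₂ := abs_le.1 (hlip s hs t ht η)
  constructor
  · linarith [hη ξ]
  · linarith [hξ η]

/-- A function that is Lipschitz on every `[0, b]` with `b < T` is differentiable almost everywhere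
on `(0, T)`. -/
lemma ae_differentiableAt_Ioo_of_lipschitz {T : ℝ} {m : ℝ → ℝ}
    (hm : ∀ b, 0 ≤ b → b < T → ∃ L : ℝ, 0 ≤ L ∧
      ∀ s ∈ Icc 0 b, ∀ t ∈ Icc 0 b, |m t - m s| ≤ L * |t - s|) :
    ∀ᵐ t, t ∈ Ioo 0 T → DifferentiableAt ℝ m t := by
  have key : ∀ q : ℚ, ∀ᵐ t : ℝ, (q : ℝ) < T → 0 ≤ (q : ℝ) → t ∈ Icc (0 : ℝ) q →
      DifferentiableWithinAt ℝ m (Icc (0 : ℝ) q) t := by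
    intro q
    by_cases hq : (q : ℝ) < T ∧ 0 ≤ (q : ℝ)
    · obtain ⟨L, hL, h⟩ := hm q hq.2 hq.1
      have hlip : LipschitzOnWith ⟨L, hL⟩ m (Icc (0 : ℝ) q) :=
        LipschitzOnWith.of_dist_le_mul fun x hx y hy => h y hy x hx
      filter_upwards [hlip.ae_differentiableWithinAt_of_mem (μ := volume)] with t ht _ _
      exact ht
    · exact Eventually.of_forall fun t h₁ h₂ => absurd ⟨h₁, h₂⟩ hq
  filter_upwards [ae_all_iff.2 key] with t ht ht'
  obtain ⟨q, hq₁, hq₂⟩ := exists_rat_btwn ht'.2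
  exact (ht q hq₂ (ht'.1.trans hq₁).le ⟨ht'.1.le, hq₁.le⟩).differentiableAt
    (Icc_mem_nhds ht'.1 hq₁)

/-- Lemma 2.6 (Constantin–Escher): if `w` is continuous on `[0,T) × ℝ` with continuous
time derivative, `t ↦ w(t,·)` is locally Lipschitz into bounded continuous functions,
and for each `t` the infimum `m(t) = infₓ w(t,x)` is attained, then `m` is locally
Lipschitz (hence differentiable a.e.), and for a.e. `t ∈ (0,T)`,
`m'(t) = ∂ₜw(t,ξ)` at every minimizing point `ξ`. -/
theorem constantin_escher {T : ℝ} (hT : 0 < T) (w : ℝ → ℝ → ℝ)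
    (hw_cont : ContinuousOn (fun p : ℝ × ℝ => w p.1 p.2) (Ico 0 T ×ˢ (univ : Set ℝ)))
    (hwt : ∀ x : ℝ, ∀ t ∈ Ico (0:ℝ) T,
      DifferentiableWithinAt ℝ (fun s => w s x) (Ico 0 T) t)
    (hwt_cont : ContinuousOn
      (fun p : ℝ × ℝ => derivWithin (fun s => w s p.2) (Ico 0 T) p.1)
      (Ico 0 T ×ˢ (univ : Set ℝ)))
    (hlip : ∀ a b : ℝ, 0 ≤ a → a ≤ b → b < T → ∃ L : ℝ, 0 ≤ L ∧
      ∀ s ∈ Icc a b, ∀ t ∈ Icc a b, ∀ x : ℝ, |w t x - w s x| ≤ L * |t - s|)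
    (hmin : ∀ t ∈ Ico (0:ℝ) T, ∃ ξ : ℝ, ∀ x : ℝ, w t ξ ≤ w t x) :
    (∀ a b : ℝ, 0 ≤ a → a ≤ b → b < T → ∃ L : ℝ, 0 ≤ L ∧
      ∀ s ∈ Icc a b, ∀ t ∈ Icc a b,
        |(⨅ x : ℝ, w t x) - (⨅ x : ℝ, w s x)| ≤ L * |t - s|) ∧
    (∀ᵐ t ∂(volume.restrict (Ioo 0 T)),
      DifferentiableAt ℝ (fun s => ⨅ x : ℝ, w s x) t ∧
      ∀ ξ : ℝ, (∀ x : ℝ, w t ξ ≤ w t x) →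
        deriv (fun s => ⨅ x : ℝ, w s x) t = derivWithin (fun s => w s ξ) (Ico 0 T) t) := by
  have hm : ∀ a b : ℝ, 0 ≤ a → a ≤ b → b < T → ∃ L : ℝ, 0 ≤ L ∧
      ∀ s ∈ Icc a b, ∀ t ∈ Icc a b,
        |(⨅ x : ℝ, w t x) - (⨅ x : ℝ, w s x)| ≤ L * |t - s| := by
    intro a b ha hab hb
    obtain ⟨L, hL, h⟩ := hlip a b ha hab hb
    exact ⟨L, hL, fun s hs t ht => abs_iInf_sub_iInf_le h
      (fun r hr => hmin r ⟨ha.trans hr.1, hr.2.trans_lt hb⟩) hs ht⟩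
  refine ⟨hm, (ae_restrict_iff' measurableSet_Ioo).2 ?_⟩
  filter_upwards [ae_differentiableAt_Ioo_of_lipschitz fun b hb hbT => hm 0 b le_rfl hb hbT]
    with t hdiff ht
  refine ⟨hdiff ht, fun ξ hξ => ?_⟩
  have hnhds : Ico 0 T ∈ 𝓝 t := Ico_mem_nhds ht.1 ht.2
  have hwd : DifferentiableAt ℝ (fun s => w s ξ) t :=
    (hwt ξ t ⟨ht.1.le, ht.2⟩).differentiableAt hnhds
  rw [derivWithin_of_mem_nhds hnhds]
  have hlocmin : IsLocalMin (fun s => w s ξ - ⨅ x : ℝ, w s x) t := by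
    filter_upwards [hnhds] with s hs
    obtain ⟨η, hη⟩ := hmin s hs
    rw [iInf_eq_of_forall_le hξ, iInf_eq_of_forall_le hη]
    linarith [hη ξ]
  have hzero := hlocmin.hasDerivAt_eq_zero (hwd.hasDerivAt.sub (hdiff ht).hasDerivAt)
  linarith
end

section
/- Let E > 0, N > 0 and T > 0, and let m : [0,T) → ℝ be differentiable with m'(t) ≤ −m(t)²/(2E) + N for all t ∈ [0,T). If m(0) < −√(2EN), then m(t) < −√(2EN) for all t ∈ [0,T) and T ≤ √(E/(2N)) · ln( (m(0) − √(2EN)) / (m(0) + √(2EN)) ). (Riccati-type blow-down lemma underlying Theorem 4.2) -/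
open Set Filter Topology Real

/-- A solution of `m' ≤ -(m² - a²)/(2E)` starting below `-a` never exceeds its initial value. -/
lemma riccati_le_initial {E a T : ℝ} (hE : 0 < E) (ha : 0 < a) {m m' : ℝ → ℝ}
    (hdiff : ∀ t ∈ Ico (0:ℝ) T, HasDerivWithinAt m (m' t) (Ico 0 T) t)
    (hineq : ∀ t ∈ Ico (0:ℝ) T, m' t ≤ -(m t ^ 2 - a ^ 2) / (2 * E))
    (h0 : m 0 < -a) : ∀ t ∈ Ico (0:ℝ) T, m t ≤ m 0 := by
  intro t ht
  have hsub : Icc 0 t ⊆ Ico 0 T := fun s hs => ⟨hs.1, hs.2.trans_lt ht.2⟩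
  refine image_le_of_deriv_right_lt_deriv_boundary' (f := m) (f' := m') (a := 0) (b := t)
    (B := fun _ => m 0) (B' := fun _ => 0)
    (fun s hs => ((hdiff s (hsub hs)).continuousWithinAt).mono hsub) ?_ le_rfl
    continuousOn_const (fun s _ => hasDerivWithinAt_const _ _ _) ?_ ⟨ht.1, le_rfl⟩
  · intro s hs
    have hs' := hsub (Ico_subset_Icc_self hs)
    refine (hdiff s hs').mono_of_mem_nhdsWithin ?_
    exact mem_of_superset (Ico_mem_nhdsGE hs'.2) fun r hr => ⟨hs'.1.trans hr.1, hr.2⟩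
  · intro s hs hms
    refine (hineq s (hsub (Ico_subset_Icc_self hs))).trans_lt ?_
    rw [hms]
    exact div_neg_of_neg_of_pos (by nlinarith) (by positivity)

/-- The function `log (a - m) - log (-a - m)` decreases at rate at least `a / E` along a solution
of `m' ≤ -(m² - a²)/(2E)` staying below `-a`. -/
lemma riccati_log_antitone {E a T : ℝ} (hE : 0 < E) (ha : 0 < a) {m m' : ℝ → ℝ}
    (hdiff : ∀ t ∈ Ico (0:ℝ) T, HasDerivWithinAt m (m' t) (Ico 0 T) t)
    (hineq : ∀ t ∈ Ico (0:ℝ) T, m' t ≤ -(m t ^ 2 - a ^ 2) / (2 * E))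
    (hlt : ∀ t ∈ Ico (0:ℝ) T, m t < -a) :
    AntitoneOn (fun t => log (a - m t) - log (-a - m t) + a / E * t) (Ico 0 T) := by
  have hderiv : ∀ t ∈ Ico (0:ℝ) T, HasDerivWithinAt
      (fun t => log (a - m t) - log (-a - m t) + a / E * t)
      (-m' t / (a - m t) - -m' t / (-a - m t) + a / E * 1) (Ico 0 T) t := by
    intro t ht
    have h := hlt t ht
    exact ((((hdiff t ht).const_sub a).log (by linarith)).sub
      (((hdiff t ht).const_sub (-a)).log (by linarith))).add
      ((hasDerivWithinAt_id t _).const_mul (a / E))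
  refine antitoneOn_of_hasDerivWithinAt_nonpos (convex_Ico 0 T)
    (fun t ht => (hderiv t ht).continuousWithinAt)
    (fun t ht => (hderiv t (interior_subset ht)).mono interior_subset) ?_
  intro t ht
  have ht' := interior_subset ht
  have h := hlt t ht'
  have hp : 0 < a - m t := by linarith
  have hq : 0 < -a - m t := by linarith
  have hle := hineq t ht'
  rw [le_div_iff₀ (by positivity)] at hle
  have key : -m' t / (a - m t) - -m' t / (-a - m t) + a / E * 1 =
      a * (m' t * (2 * E) + (m t ^ 2 - a ^ 2)) / ((a - m t) * (-a - m t) * E) := by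
    field_simp
    ring
  rw [key]
  exact div_nonpos_of_nonpos_of_nonneg
    (mul_nonpos_of_nonneg_of_nonpos ha.le (by linarith)) (by positivity)

/-- Riccati-type blow-down lemma underlying Theorem 4.2: if `E, N > 0`,
`m' ≤ -m²/(2E) + N` on `[0,T)` and `m(0) < -√(2EN)`, then `m(t) < -√(2EN)`
throughout and `T ≤ √(E/(2N))·ln((m(0) - √(2EN))/(m(0) + √(2EN)))`. -/
theorem riccati_blowdown {E N T : ℝ} (hE : 0 < E) (hN : 0 < N) (hT : 0 < T)
    (m m' : ℝ → ℝ)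
    (hdiff : ∀ t ∈ Ico (0:ℝ) T, HasDerivWithinAt m (m' t) (Ico 0 T) t)
    (hineq : ∀ t ∈ Ico (0:ℝ) T, m' t ≤ -(m t) ^ 2 / (2 * E) + N)
    (h0 : m 0 < -Real.sqrt (2 * E * N)) :
    (∀ t ∈ Ico (0:ℝ) T, m t < -Real.sqrt (2 * E * N)) ∧
    T ≤ Real.sqrt (E / (2 * N)) *
      Real.log ((m 0 - Real.sqrt (2 * E * N)) / (m 0 + Real.sqrt (2 * E * N))) := by
  have ha : 0 < √(2 * E * N) := by positivity
  have hsq : √(2 * E * N) ^ 2 = 2 * E * N := sq_sqrt (by positivity)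
  have hcoef : √(E / (2 * N)) = E / √(2 * E * N) := by
    rw [sqrt_eq_iff_mul_self_eq (by positivity) (by positivity), div_mul_div_comm,
      ← sq √(2 * E * N), hsq]
    field_simp
  rw [hcoef]
  generalize √(2 * E * N) = a at *
  have hineq' : ∀ t ∈ Ico (0:ℝ) T, m' t ≤ -(m t ^ 2 - a ^ 2) / (2 * E) := by
    intro t ht
    refine (hineq t ht).trans_eq ?_
    rw [hsq]
    field_simp
    ring
  have hlt : ∀ t ∈ Ico (0:ℝ) T, m t < -a := fun t ht =>
    (riccati_le_initial hE ha hdiff hineq' h0 t ht).trans_lt h0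
  refine ⟨hlt, le_of_forall_lt_imp_le_of_dense fun s hs => ?_⟩
  have hlog : log ((m 0 - a) / (m 0 + a)) = log (a - m 0) - log (-a - m 0) := by
    rw [← log_div (by linarith) (by linarith), ← neg_div_neg_eq]
    ring_nf
  have hlog_pos : 0 ≤ log (a - m 0) - log (-a - m 0) :=
    sub_nonneg.2 (log_le_log (by linarith) (by linarith))
  rw [hlog]
  rcases le_total s 0 with hs0 | hs0
  · exact hs0.trans (by positivity)
  have hmem : s ∈ Ico 0 T := ⟨hs0, hs⟩
  have hanti := riccati_log_antitone hE ha hdiff hineq' hlt ⟨le_rfl, hT⟩ hmem hs0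
  have hpos : log (-a - m s) ≤ log (a - m s) :=
    log_le_log (by linarith [hlt s hmem]) (by linarith)
  have hs_le : a / E * s ≤ log (a - m 0) - log (-a - m 0) := by
    simp only [mul_zero, add_zero] at hanti
    linarith
  calc s = E / a * (a / E * s) := by field_simp
    _ ≤ _ := by gcongr
end

section
/- Let σ < 0, K ≥ 0 and 0 < T < ∞, and let M : [0,T) → ℝ be locally Lipschitz with |M'(t) + (σ/2)M(t)²| ≤ K for almost every t ∈ (0,T). If M(t) → +∞ as t → T⁻, then lim_{t→T⁻} (T − t)·M(t) = −2/σ. (ODE core of Theorem 5.1, the blow-up rate) -/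
open Set Filter MeasureTheory Topology Real

/-- A Lipschitz function on `[a, b]` whose derivative is bounded almost everywhere by `C`
varies by at most `C * (b - a)`. -/
theorem LipschitzOnWith.abs_sub_le_of_ae_abs_deriv_le {f : ℝ → ℝ} {a b C : ℝ} {L : NNReal}
    (hab : a ≤ b) (hf : LipschitzOnWith L f (Icc a b))
    (hC : ∀ᵐ t, t ∈ Ioo a b → |deriv f t| ≤ C) : |f b - f a| ≤ C * (b - a) := by
  rw [← uIcc_of_le hab] at hf
  rw [← hf.absolutelyContinuousOnInterval.integral_deriv_eq_sub, ← Real.norm_eq_abs,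
    ← abs_of_nonneg (sub_nonneg.2 hab)]
  apply intervalIntegral.norm_integral_le_of_norm_le_const_ae
  have hb : ∀ᵐ t : ℝ, t ≠ b := by simp [ae_iff]
  filter_upwards [hC, hb] with t ht htb hmem
  rw [uIoc_of_le hab] at hmem
  exact ht ⟨hmem.1, lt_of_le_of_ne hmem.2 htb⟩

/-- The reciprocal of a Lipschitz function that is at least `1` is Lipschitz. -/
theorem LipschitzOnWith.inv_of_one_le {f : ℝ → ℝ} {s : Set ℝ} {L : NNReal}
    (hf : LipschitzOnWith L f s) (h1 : ∀ t ∈ s, 1 ≤ f t) :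
    LipschitzOnWith L (fun t => (f t)⁻¹) s := by
  refine LipschitzOnWith.of_dist_le_mul fun x hx y hy => ?_
  have hx1 := h1 x hx
  have hy1 := h1 y hy
  refine le_trans ?_ (hf.dist_le_mul x hx y hy)
  rw [dist_inv_inv₀ (by positivity) (by positivity)]
  refine div_le_self dist_nonneg ?_
  rw [Real.norm_of_nonneg (by positivity), Real.norm_of_nonneg (by positivity)]
  exact one_le_mul_of_one_le_of_one_le hx1 hy1

/-- If `f' = -c f² + O(K)` almost everywhere on `[a, b]` and `f ≥ R ≥ 1` there, then `1 / f` is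
affine with slope `c` up to an error of slope `K / R²`. -/
theorem LipschitzOnWith.abs_inv_sub_inv_sub_le {f : ℝ → ℝ} {a b c K R : ℝ} {L : NNReal}
    (hab : a ≤ b) (hK : 0 ≤ K) (hR : 1 ≤ R) (hf : LipschitzOnWith L f (Icc a b))
    (hfR : ∀ t ∈ Icc a b, R ≤ f t)
    (hae : ∀ᵐ t, t ∈ Ioo a b → DifferentiableAt ℝ f t ∧ |deriv f t + c * f t ^ 2| ≤ K) :
    |(f b)⁻¹ - (f a)⁻¹ - c * (b - a)| ≤ K / R ^ 2 * (b - a) := by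
  have hg := (hf.inv_of_one_le fun t ht => hR.trans (hfR t ht)).sub
    (lipschitzWith_smul c).lipschitzOnWith
  have key := hg.abs_sub_le_of_ae_abs_deriv_le (C := K / R ^ 2) hab ?_
  · convert key using 2
    simp only [smul_eq_mul]
    ring
  filter_upwards [hae] with t ht hmem
  obtain ⟨hd, hle⟩ := ht hmem
  have hRt := hfR t (Ioo_subset_Icc_self hmem)
  have hpos : 0 < f t := by linarith
  have hder : HasDerivAt (fun x => (f x)⁻¹ - c • x) (-deriv f t / f t ^ 2 - c) t := by
    exact (hd.hasDerivAt.inv hpos.ne').sub (((hasDerivAt_id t).const_smul c).congr_deriv (by simp))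
  rw [hder.deriv, show -deriv f t / f t ^ 2 - c = -((deriv f t + c * f t ^ 2) / f t ^ 2) by
    field_simp; ring, abs_neg, abs_div, abs_of_pos (by positivity : 0 < f t ^ 2)]
  gcongr

/-- ODE core of Theorem 5.1 (the blow-up rate): if `σ < 0`, `M` is locally Lipschitz
on `[0,T)` with `|M' + (σ/2)M²| ≤ K` a.e., and `M(t) → +∞` as `t → T⁻`, then
`(T - t)·M(t) → -2/σ` as `t → T⁻`. -/
theorem blowup_rate_ode {σ K T : ℝ} (hσ : σ < 0) (hK : 0 ≤ K) (hT : 0 < T)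
    (M : ℝ → ℝ)
    (hlip : ∀ b ∈ Ico (0:ℝ) T, ∃ L : NNReal, LipschitzOnWith L M (Icc 0 b))
    (hae : ∀ᵐ t ∂(volume.restrict (Ioo 0 T)),
      DifferentiableAt ℝ M t ∧ |deriv M t + σ / 2 * (M t) ^ 2| ≤ K)
    (hblow : Tendsto M (𝓝[<] T) atTop) :
    Tendsto (fun t => (T - t) * M t) (𝓝[<] T) (𝓝 (-2 / σ)) := by
  rw [ae_restrict_iff' measurableSet_Ioo] at hae
  have hmain : Tendsto (fun t => (M t)⁻¹ / (T - t)) (𝓝[<] T) (𝓝 (-(σ / 2))) := by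
    rw [Metric.tendsto_nhds]
    intro ε hε
    obtain ⟨R, hRε, hR⟩ : ∃ R : ℝ, K / R ^ 2 < ε ∧ 1 ≤ R :=
      (((tendsto_const_nhds.div_atTop (tendsto_pow_atTop two_ne_zero)).eventually
        (gt_mem_nhds hε)).and (eventually_ge_atTop 1)).exists
    obtain ⟨l, hl, hlR⟩ := mem_nhdsLT_iff_exists_Ioo_subset.1 (hblow.eventually_ge_atTop R)
    filter_upwards [Ioo_mem_nhdsLT hl, Ioo_mem_nhdsLT hT] with a hla ha
    have hTa : 0 < T - a := sub_pos.2 ha.2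
    have hbound : ∀ᶠ b in 𝓝[<] T,
        |(M b)⁻¹ - (M a)⁻¹ - σ / 2 * (b - a)| ≤ K / R ^ 2 * (b - a) := by
      filter_upwards [Ioo_mem_nhdsLT ha.2] with b hb
      obtain ⟨L, hL⟩ := hlip b ⟨(ha.1.trans hb.1).le, hb.2⟩
      refine (hL.mono (Icc_subset_Icc_left ha.1.le)).abs_inv_sub_inv_sub_le hb.1.le hK hR
        (fun t ht => hlR ⟨hla.1.trans_le ht.1, ht.2.trans_lt hb.2⟩) ?_
      filter_upwards [hae] with t ht hmem
      exact ht ⟨ha.1.trans hmem.1, hmem.2.trans hb.2⟩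
    have hid : Tendsto (fun b : ℝ => b - a) (𝓝[<] T) (𝓝 (T - a)) :=
      (tendsto_nhdsWithin_of_tendsto_nhds tendsto_id).sub_const a
    have hlim := le_of_tendsto_of_tendsto
      (((hblow.inv_tendsto_atTop.sub_const (M a)⁻¹).sub (hid.const_mul (σ / 2))).abs)
      (hid.const_mul (K / R ^ 2)) hbound
    rw [Real.dist_eq, show (M a)⁻¹ / (T - a) - -(σ / 2)
      = -((0 - (M a)⁻¹ - σ / 2 * (T - a)) / (T - a)) by field_simp; ring,
      abs_neg, abs_div, abs_of_pos hTa]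
    exact ((div_le_iff₀ hTa).2 hlim).trans_lt hRε
  have hinv := hmain.inv₀ (by linarith : 0 < -(σ / 2)).ne'
  rw [show -2 / σ = (-(σ / 2))⁻¹ by field_simp]
  refine hinv.congr fun t => ?_
  rw [inv_div, div_inv_eq_mul]
end
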